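/- arXiv:1801.05536 — 4 statements merged into one kernel-verified Lean document; each statement's English description precedes it below -/
import Mathlib

section
/- Every nontrivial finite solvable group G of odd order with derived length d satisfies (7 : ℝ)^((d−2)/5) < Ω(|G|), where Ω(|G|) is the number of prime factors of |G| counted with multiplicity. -/
/-- `Omega n` is the number of prime factors of `n` counted with multiplicity,
usually denoted `Ω(n)`.  For a finite solvable group `G`, `Omega (Nat.card G)`
is the composition length of `G`. -/
def Omega (n : ℕ) : ℕ := n.primeFactorsList.length

/-- `DerivedLengthEq G d` says that the derived (solvable) length of `G` is exactly `d`: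
the `d`-th term of the derived series is trivial and no earlier term is trivial. -/
def DerivedLengthEq (G : Type*) [Group G] (d : ℕ) : Prop :=
  derivedSeries G d = ⊥ ∧ ∀ k < d, derivedSeries G k ≠ ⊥

open scoped commutatorElement TensorProduct
universe u

/-- bound for permutation groups -/
def hp (s : ℕ) : ℕ := Nat.log 7 (s ^ 2)

/-- bound for linear groups -/
def gl (m : ℕ) : ℕ := if m ≤ 2 then 1 else if m ≤ 4 then 2 else hp m + 2

theorem hp_pow_le {s : ℕ} (h : s ≠ 0) : 7 ^ hp s ≤ s ^ 2 :=
  Nat.pow_log_le_self 7 (by positivity)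

theorem le_hp {s d : ℕ} (h : 7 ^ d ≤ s ^ 2) : d ≤ hp s :=
  Nat.le_log_of_pow_le (by norm_num) h

theorem hp_mono {a b : ℕ} (h : a ≤ b) : hp a ≤ hp b :=
  Nat.log_mono_right (Nat.pow_le_pow_left h 2)

theorem hp_mul {a b c : ℕ} (ha : a ≠ 0) (hb : b ≠ 0) (h : a * b ≤ c) : hp a + hp b ≤ hp c := by
  apply le_hp
  calc 7 ^ (hp a + hp b) = 7 ^ hp a * 7 ^ hp b := pow_add _ _ _
    _ ≤ a ^ 2 * b ^ 2 := Nat.mul_le_mul (hp_pow_le ha) (hp_pow_le hb)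
    _ = (a * b) ^ 2 := by ring
    _ ≤ c ^ 2 := Nat.pow_le_pow_left h 2

theorem hp_two : hp 2 = 0 := by
  unfold hp; rw [Nat.log_eq_zero_iff]; norm_num

theorem hp_three : 1 ≤ hp 3 := le_hp (by norm_num)

theorem hp_lt {s d : ℕ} (h : s ^ 2 < 7 ^ d) (hd : s ≠ 0) : hp s < d :=
  Nat.log_lt_of_lt_pow (by positivity) h

theorem gl_pos (m : ℕ) : 1 ≤ gl m := by
  unfold gl; split_ifs <;> omega

theorem gl_mono {a b : ℕ} (h : a ≤ b) : gl a ≤ gl b := by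
  unfold gl
  have := hp_mono h
  split_ifs <;> omega

theorem gl_le (m : ℕ) : gl m ≤ hp m + 2 := by
  unfold gl; split_ifs <;> omega

theorem arith_case1 {s m' m : ℕ} (hs : 2 ≤ s) (hm' : 1 ≤ m') (h : s * m' ≤ m) :
    hp s + gl m' ≤ gl m := by
  have hsm : s ≤ m := le_trans (Nat.le_mul_of_pos_right s hm') h
  have h1 := hp_mono hsm
  have h2 : hp s + hp m' ≤ hp m := hp_mul (by omega) (by omega) h
  by_cases h3 : m ≤ 2
  · have : s = 2 := by omega
    subst this
    have : m' ≤ 1 := by omega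
    rw [hp_two]
    unfold gl; split_ifs <;> omega
  by_cases h4 : m ≤ 4
  · have : m' ≤ 2 := by nlinarith
    have h5 : hp s < 2 := hp_lt (by nlinarith) (by omega)
    unfold gl; split_ifs <;> omega
  · unfold gl; split_ifs <;> omega

theorem nat_aux1 : ∀ b : ℕ, 5 ≤ b → 343 * b ^ 2 ≤ 3 ^ (2 * b) := by
  intro b hb
  induction b, hb using Nat.le_induction with
  | base => norm_num
  | succ n hn ih =>
    have : 3 ^ (2 * (n + 1)) = 9 * 3 ^ (2 * n) := by ring
    rw [this]; nlinarith

theorem nat_aux2 : ∀ b : ℕ, 8 ≤ b → 49 * b ^ 2 ≤ 3 ^ b := by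
  intro b hb
  induction b, hb using Nat.le_induction with
  | base => norm_num
  | succ n hn ih =>
    have : 3 ^ (n + 1) = 3 * 3 ^ n := by ring
    rw [this]; nlinarith

theorem prime_odd_cases {r : ℕ} (hr : r.Prime) (h2 : r ≠ 2) : r = 3 ∨ r = 5 ∨ 7 ≤ r := by
  have := hr.two_le
  by_contra hcon
  have : r < 7 := by omega
  interval_cases r <;> first | omega | (norm_num at hr)

theorem arith_perm {r b : ℕ} (hr : 3 ≤ r) (hb : 1 ≤ b) (h : b = 1 → 7 ≤ r) :
    1 + gl b ≤ hp (r ^ b) := by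
  have h3 : 3 ^ b ≤ r ^ b := Nat.pow_le_pow_left hr b
  have key : ∀ d, 7 ^ d ≤ (3 ^ b) ^ 2 → d ≤ hp (r ^ b) := fun d hd =>
    le_trans (le_hp hd) (hp_mono h3)
  by_cases h1 : b = 1
  · subst h1
    have := h rfl
    have : 2 ≤ hp (r ^ 1) := le_hp (by rw [pow_one]; nlinarith)
    simpa [gl] using this
  by_cases h5 : b < 5
  · have : b = 2 ∨ b = 3 ∨ b = 4 := by omega
    rcases this with rfl | rfl | rfl
    · have := key 2 (by norm_num); simpa [gl] using this
    · have := key 3 (by norm_num); simpa [gl] using this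
    · have := key 3 (by norm_num); simpa [gl] using this
  · apply key
    have h6 := gl_le b
    have h7 := hp_pow_le (s := b) (by omega)
    have h8 := nat_aux1 b (by omega)
    calc 7 ^ (1 + gl b) ≤ 7 ^ (hp b + 3) := Nat.pow_le_pow_right (by norm_num) (by omega)
      _ = 343 * 7 ^ hp b := by rw [pow_add]; ring
      _ ≤ 343 * b ^ 2 := by omega
      _ ≤ 3 ^ (2 * b) := h8
      _ = (3 ^ b) ^ 2 := by rw [mul_comm, pow_mul]

theorem gl_le_hp_pow {r b j : ℕ} (hr : 3 ≤ r) (hb : 2 ≤ b) (hj : b ≤ 2 * j) :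
    gl b ≤ hp (r ^ j) := by
  have h3 : 3 ^ j ≤ r ^ j := Nat.pow_le_pow_left hr j
  refine le_trans ?_ (hp_mono h3)
  have key : ∀ j', j' ≤ j → hp (3 ^ j') ≤ hp (3 ^ j) := fun j' h =>
    hp_mono (Nat.pow_le_pow_right (by norm_num) h)
  by_cases h2 : b = 2
  · subst h2
    have h1 : 1 ≤ hp (3 ^ 1) := le_hp (by norm_num)
    have h2 := key 1 (by omega)
    simp [gl] at *; omega
  by_cases h4 : b ≤ 4
  · have h1 : 2 ≤ hp (3 ^ 2) := le_hp (by norm_num)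
    have h2 := key 2 (by omega)
    have : gl b ≤ gl 4 := gl_mono h4
    simp [gl] at *; omega
  by_cases h6 : b ≤ 6
  · have h1 : 3 ≤ hp (3 ^ 3) := le_hp (by norm_num)
    have h2 := key 3 (by omega)
    have h3 : hp b < 2 := hp_lt (by nlinarith) (by omega)
    have := gl_le b
    omega
  by_cases h8 : b ≤ 8
  · have h1 : 4 ≤ hp (3 ^ 4) := le_hp (by norm_num)
    have h2 := key 4 (by omega)
    have h3 : hp b < 3 := hp_lt (by nlinarith) (by omega)
    have := gl_le b
    omega
  · apply le_hp
    have h6 := gl_le b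
    have h7 := hp_pow_le (s := b) (by omega)
    have h8 := nat_aux2 b (by omega)
    calc 7 ^ (gl b) ≤ 7 ^ (hp b + 2) := Nat.pow_le_pow_right (by norm_num) (by omega)
      _ = 49 * 7 ^ hp b := by rw [pow_add]; ring
      _ ≤ 49 * b ^ 2 := by omega
      _ ≤ 3 ^ b := h8
      _ ≤ 3 ^ (2 * j) := Nat.pow_le_pow_right (by norm_num) hj
      _ = (3 ^ j) ^ 2 := by rw [mul_comm, pow_mul]

theorem arith_case2 {r b j m' m : ℕ} (hr : r.Prime) (hr2 : r ≠ 2) (hb : 2 ≤ b) (hj : b ≤ 2 * j)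
    (hm' : 1 ≤ m') (h : r ^ j * m' ≤ m) (hne : ¬ (r = 3 ∧ b = 2)) :
    gl b + max 2 (gl m') ≤ gl m := by
  have hr3 : 3 ≤ r := by have := hr.two_le; omega
  have h0 : r ^ j ≠ 0 := by positivity
  have h5 : 5 ≤ r ^ j := by
    by_cases hj1 : j = 1
    · subst hj1
      have : b = 2 := by omega
      rcases prime_odd_cases hr hr2 with h | h | h
      · exact absurd ⟨h, this⟩ hne
      · simp [h]
      · rw [pow_one]; omega
    · calc 5 ≤ 3 ^ 2 := by norm_num
        _ ≤ r ^ 2 := Nat.pow_le_pow_left hr3 2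
        _ ≤ r ^ j := Nat.pow_le_pow_right (by omega) (by omega)
  have hm : r ^ j ≤ m := le_trans (Nat.le_mul_of_pos_right _ hm') h
  have h1 := hp_mono hm
  have h2 : hp (r ^ j) + hp m' ≤ hp m := hp_mul h0 (by omega) h
  have h3 := gl_le_hp_pow hr3 hb hj
  have h6 : gl m = hp m + 2 := by unfold gl; split_ifs <;> omega
  have h7 : gl m' ≤ hp m' + 2 := gl_le m'
  rw [h6]
  rcases max_cases 2 (gl m') with ⟨h, -⟩ | ⟨h, -⟩ <;> rw [h] <;> omega

theorem arith_case3 {m' m : ℕ} (hm' : 1 ≤ m') (h : 3 * m' ≤ m) : max 2 (gl m') ≤ gl m := by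
  apply max_le
  · exact le_trans (by simp [gl]) (gl_mono (show 3 ≤ m by omega))
  · exact gl_mono (by omega)

theorem amgm {x y : ℕ} (hx : 1 ≤ x) (hy : 1 ≤ y) : 7 * y ^ 3 * x ^ 2 < (x + y) ^ 5 := by
  have h1 : 4 * (x * y) ≤ (x + y) ^ 2 := by nlinarith [sq_nonneg ((x : ℤ) - y), four_mul_le_sq_add x y]
  have h2 : 7 * y ^ 3 * x ^ 2 * 16 ≤ 7 * y * (x + y) ^ 4 := by
    have := Nat.mul_le_mul h1 h1
    nlinarith
  have h3 : 7 * y * (x + y) ^ 4 < 16 * (x + y) ^ 5 := by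
    have : 0 < (x + y) ^ 4 := by positivity
    rw [pow_succ (x + y) 4]; nlinarith
  nlinarith

theorem arith_final {d k m n : ℕ} (hk : 1 ≤ k) (hm : 1 ≤ m) (hd : d ≤ gl m + k)
    (hn : m + 2 ^ (k - 1) ≤ n) : 7 ^ d < 49 * n ^ 5 := by
  obtain ⟨k, rfl⟩ : ∃ k', k = k' + 1 := ⟨k - 1, by omega⟩
  simp only [Nat.add_sub_cancel] at hn
  have h1 := gl_le m
  have h2 := hp_pow_le (s := m) (by omega)
  have h3 := amgm hm (Nat.one_le_two_pow (n := k))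
  have h4 : 7 ^ k ≤ (2 ^ k) ^ 3 := by
    rw [← pow_mul, mul_comm, pow_mul]; exact Nat.pow_le_pow_left (by norm_num) k
  calc 7 ^ d ≤ 7 ^ (hp m + k + 3) := Nat.pow_le_pow_right (by norm_num) (by omega)
    _ = 49 * (7 * 7 ^ k * 7 ^ hp m) := by ring
    _ ≤ 49 * (7 * (2 ^ k) ^ 3 * m ^ 2) := by gcongr
    _ < 49 * (m + 2 ^ k) ^ 5 := by omega
    _ ≤ 49 * n ^ 5 := by gcongr

theorem arith_final2 {d k n : ℕ} (hk : 1 ≤ k) (hd : d ≤ k) (hn : 2 ^ (k - 1) ≤ n) :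
    7 ^ d < 49 * n ^ 5 := by
  obtain ⟨k, rfl⟩ : ∃ k', k = k' + 1 := ⟨k - 1, by omega⟩
  simp only [Nat.add_sub_cancel] at hn
  have h4 : 7 ^ k ≤ (2 ^ k) ^ 3 := by
    rw [← pow_mul, mul_comm, pow_mul]; exact Nat.pow_le_pow_left (by norm_num) k
  have h5 : 0 < n := lt_of_lt_of_le (by positivity) hn
  calc 7 ^ d ≤ 7 ^ (k + 1) := Nat.pow_le_pow_right (by norm_num) (by omega)
    _ = 7 * 7 ^ k := by ring
    _ ≤ 7 * n ^ 3 := by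
        have := Nat.pow_le_pow_left hn 3
        omega
    _ < 49 * n ^ 3 := by have : 0 < n ^ 3 := by positivity
                         omega
    _ ≤ 49 * n ^ 5 := by
        have : n ^ 3 ≤ n ^ 5 := Nat.pow_le_pow_right h5 (by norm_num)
        omega

set_option linter.style.haveILetI false
section DS
variable {G : Type*} [Group G]

/-- derived series of a subgroup, inside the ambient group -/
def ds (A : Subgroup G) : ℕ → Subgroup G
  | 0 => A
  | k + 1 => ⁅ds A k, ds A k⁆

theorem ds_zero (A : Subgroup G) : ds A 0 = A := rfl
theorem ds_succ (A : Subgroup G) (k : ℕ) : ds A (k + 1) = ⁅ds A k, ds A k⁆ := rfl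

theorem ds_top (k : ℕ) : ds (⊤ : Subgroup G) k = derivedSeries G k := by
  induction k with
  | zero => rfl
  | succ k ih => rw [ds_succ, ih]; rfl

theorem ds_add (A : Subgroup G) (a b : ℕ) : ds A (a + b) = ds (ds A a) b := by
  induction b with
  | zero => rfl
  | succ b ih => rw [← add_assoc, ds_succ, ds_succ, ih]

theorem ds_mono {A B : Subgroup G} (h : A ≤ B) (k : ℕ) : ds A k ≤ ds B k := by
  induction k with
  | zero => exact h
  | succ k ih => exact Subgroup.commutator_mono ih ih

theorem ds_succ_le (A : Subgroup G) (k : ℕ) : ds A (k + 1) ≤ ds A k := by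
  rw [ds_succ, Subgroup.commutator_le]
  intro x hx y hy
  rw [commutatorElement_def]
  exact mul_mem (mul_mem (mul_mem hx hy) (inv_mem hx)) (inv_mem hy)

theorem ds_anti (A : Subgroup G) {a b : ℕ} (h : a ≤ b) : ds A b ≤ ds A a :=
  antitone_nat_of_succ_le (ds_succ_le A) h

theorem ds_le (A : Subgroup G) (k : ℕ) : ds A k ≤ A := ds_anti A (Nat.zero_le k)

theorem ds_map {H : Type*} [Group H] (f : G →* H) (A : Subgroup G) (k : ℕ) :
    (ds A k).map f = ds (A.map f) k := by
  induction k with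
  | zero => rfl
  | succ k ih => rw [ds_succ, ds_succ, Subgroup.map_commutator, ih]

theorem ds_normal (A : Subgroup G) [A.Normal] (k : ℕ) : (ds A k).Normal := by
  induction k with
  | zero => assumption
  | succ k ih => rw [ds_succ]; infer_instance

theorem ds_subtype (A : Subgroup G) (k : ℕ) :
    (ds (⊤ : Subgroup A) k).map A.subtype = ds A k := by
  rw [ds_map]; simp [← MonoidHom.range_eq_map]

theorem ds_hom {H : Type*} [Group H] (f : G →* H) {x : G} {k : ℕ}
    (hx : x ∈ ds (⊤ : Subgroup G) k) : f x ∈ ds (⊤ : Subgroup H) k := by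
  have : f x ∈ (ds (⊤ : Subgroup G) k).map f := Subgroup.mem_map_of_mem f hx
  rw [ds_map] at this
  exact ds_mono le_top k this

theorem ds_sup {A B : Subgroup G} [A.Normal] [B.Normal] (h : ∀ a ∈ A, ∀ b ∈ B, a * b = b * a)
    (k : ℕ) : ds (A ⊔ B) k ≤ ds A k ⊔ ds B k := by
  induction k with
  | zero => exact le_rfl
  | succ k ih =>
    have := ds_normal A k
    have := ds_normal B k
    rw [ds_succ]
    refine le_trans (Subgroup.commutator_mono ih ih) ?_
    rw [Subgroup.commutator_le]
    intro x hx y hy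
    rw [Subgroup.mem_sup_of_normal_right] at hx hy
    obtain ⟨a, ha, b, hb, rfl⟩ := hx
    obtain ⟨c, hc, d, hd, rfl⟩ := hy
    have e1 := h c (ds_le A k hc) b (ds_le B k hb)
    have e2 := h c⁻¹ (inv_mem (ds_le A k hc)) b (ds_le B k hb)
    have e3 := h a (ds_le A k ha) b (ds_le B k hb)
    have e4 := h a⁻¹ (inv_mem (ds_le A k ha)) b (ds_le B k hb)
    have e5 := h c (ds_le A k hc) d (ds_le B k hd)
    have e6 := h a⁻¹ (inv_mem (ds_le A k ha)) d (ds_le B k hd)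
    have e7 := h c⁻¹ (inv_mem (ds_le A k hc)) d (ds_le B k hd)
    have e8 := h c⁻¹ (inv_mem (ds_le A k hc)) b⁻¹ (inv_mem (ds_le B k hb))
    have e9 := h a⁻¹ (inv_mem (ds_le A k ha)) b⁻¹ (inv_mem (ds_le B k hb))
    have e10 := h c⁻¹ (inv_mem (ds_le A k hc)) d⁻¹ (inv_mem (ds_le B k hd))
    have : ⁅a * b, c * d⁆ = ⁅a, c⁆ * ⁅b, d⁆ := by
      simp only [commutatorElement_def, mul_inv_rev]
      calc a * b * (c * d) * (b⁻¹ * a⁻¹) * (d⁻¹ * c⁻¹)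
          = a * (b * c) * d * (b⁻¹ * a⁻¹) * (d⁻¹ * c⁻¹) := by group
        _ = a * c * b * d * (a⁻¹ * b⁻¹) * (c⁻¹ * d⁻¹) := by rw [← e1, ← e9, ← e10]; group
        _ = a * c * b * (d * a⁻¹) * (b⁻¹ * c⁻¹) * d⁻¹ := by group
        _ = a * c * (b * a⁻¹) * d * c⁻¹ * b⁻¹ * d⁻¹ := by rw [← e6, ← e8]; group
        _ = a * c * a⁻¹ * b * (d * c⁻¹) * b⁻¹ * d⁻¹ := by rw [← e4]; group
        _ = a * c * a⁻¹ * (b * c⁻¹) * d * b⁻¹ * d⁻¹ := by rw [← e7]; group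
        _ = a * c * a⁻¹ * c⁻¹ * (b * d * b⁻¹ * d⁻¹) := by rw [← e2]; group
    rw [this]
    exact Subgroup.mul_mem_sup (Subgroup.commutator_mem_commutator ha hc)
      (Subgroup.commutator_mem_commutator hb hd)

end DS

theorem exists_min_normal {Q : Type*} [Group Q] [Finite Q] (hs : Group.IsSolvable Q)
    (C : Subgroup Q) [hC : C.Normal] (hC1 : C ≠ ⊥) :
    ∃ N : Subgroup Q, N.Normal ∧ N ≤ C ∧ N ≠ ⊥ ∧
      (∀ M : Subgroup Q, M.Normal → M ≤ N → M = ⊥ ∨ M = N) ∧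
      ∃ r : ℕ, r.Prime ∧ (∀ x ∈ N, x ^ r = 1) ∧ (∀ x ∈ N, ∀ y ∈ N, x * y = y * x) ∧
        ∃ b : ℕ, 1 ≤ b ∧ Nat.card N = r ^ b := by
  let S : Set (Subgroup Q) := {N | N.Normal ∧ N ≤ C ∧ N ≠ ⊥}
  have hSf : S.Finite := Set.toFinite _
  have hSne : S.Nonempty := ⟨C, hC, le_rfl, hC1⟩
  obtain ⟨N, hN⟩ := hSf.exists_minimal hSne
  obtain ⟨⟨hNn, hNC, hN1⟩, hmin⟩ := hN
  have hmin' : ∀ M : Subgroup Q, M.Normal → M ≤ N → M = ⊥ ∨ M = N := by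
    intro M hM hMN
    by_cases h : M = ⊥
    · exact Or.inl h
    · exact Or.inr (le_antisymm hMN (hmin ⟨hM, hMN.trans hNC, h⟩ hMN))
  refine ⟨N, hNn, hNC, hN1, hmin', ?_⟩
  have hcomm : ⁅N, N⁆ = ⊥ := by
    rcases hmin' ⁅N, N⁆ inferInstance (Subgroup.commutator_le_left N N) with h | h
    · exact h
    · exfalso
      have hk : ∀ k, ds N k = N := by
        intro k
        induction k with
        | zero => rfl
        | succ k ih => rw [ds_succ, ih, h]
      obtain ⟨n, hn⟩ := hs.solvable
      have h1 : ds N n ≤ ds ⊤ n := ds_mono le_top n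
      rw [hk, ds_top, hn] at h1
      exact hN1 (le_bot_iff.mp h1)
  have hc : ∀ x ∈ N, ∀ y ∈ N, x * y = y * x := by
    intro x hx y hy
    have : ⁅x, y⁆ ∈ ⁅N, N⁆ := Subgroup.commutator_mem_commutator hx hy
    rw [hcomm, Subgroup.mem_bot, commutatorElement_eq_one_iff_mul_comm] at this
    exact this
  have hcard : Nat.card N ≠ 1 := by
    rw [Ne, Subgroup.card_eq_one]; exact hN1
  obtain ⟨r, hr, hrd⟩ := Nat.exists_prime_and_dvd hcard
  have := Fact.mk hr
  obtain ⟨a, ha⟩ := exists_prime_orderOf_dvd_card' r hrd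
  let M : Subgroup Q :=
    { carrier := {x | x ∈ N ∧ x ^ r = 1}
      one_mem' := ⟨N.one_mem, one_pow _⟩
      mul_mem' := by
        rintro x y ⟨hx, hx'⟩ ⟨hy, hy'⟩
        refine ⟨N.mul_mem hx hy, ?_⟩
        rw [(show Commute x y from hc x hx y hy).mul_pow, hx', hy', one_mul]
      inv_mem' := by
        rintro x ⟨hx, hx'⟩
        exact ⟨N.inv_mem hx, by rw [inv_pow, hx', inv_one]⟩ }
  have hM : M.Normal := ⟨by
    rintro x ⟨hx, hx'⟩ g
    refine ⟨hNn.conj_mem x hx g, ?_⟩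
    rw [conj_pow, hx']; group⟩
  have hMN : M = N := by
    rcases hmin' M hM (fun x hx => hx.1) with h | h
    · exfalso
      have : (a : Q) ∈ M := ⟨a.2, by
        have := pow_orderOf_eq_one a
        rw [ha] at this
        exact_mod_cast congrArg Subtype.val this⟩
      rw [h, Subgroup.mem_bot] at this
      have h2 : a = 1 := Subtype.ext this
      rw [h2, orderOf_one] at ha
      exact hr.one_lt.ne ha
    · exact h
  have hexp : ∀ x ∈ N, x ^ r = 1 := by
    intro x hx
    rw [← hMN] at hx
    exact hx.2
  refine ⟨r, hr, hexp, hc, ?_⟩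
  have hp : IsPGroup r N := fun x => ⟨1, by
    rw [pow_one]; exact Subtype.ext (hexp x x.2)⟩
  obtain ⟨b, hb⟩ := IsPGroup.iff_card.mp hp
  refine ⟨b, ?_, hb⟩
  rcases Nat.eq_zero_or_pos b with h | h
  · rw [h, pow_zero] at hb; exact absurd hb hcard
  · exact h

theorem fix_abs {Q A : Type*} [Group Q] [Group A] [Finite A] {r b : ℕ} (hr : r.Prime)
    (hb : 1 ≤ b) (hcard : Nat.card A = r ^ b) (φ : Q →* MulAut A) (R : Subgroup Q)
    (hR : ∀ x ∈ R, ∃ j, φ x ^ (r ^ j) = 1) : ∃ a : A, a ≠ 1 ∧ ∀ x ∈ R, φ x a = a := by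
  have := Fact.mk hr
  have hp : IsPGroup r (R.map φ) := by
    rintro ⟨y, x, hx, rfl⟩
    obtain ⟨j, hj⟩ := hR x hx
    exact ⟨j, Subtype.ext (by simpa using hj)⟩
  have hdvd : r ∣ Nat.card A := by rw [hcard]; exact dvd_pow_self r (by omega)
  have h1 : (1 : A) ∈ MulAction.fixedPoints (R.map φ) A := by
    rintro ⟨y, hy⟩
    exact map_one y
  obtain ⟨a, ha, hne⟩ := hp.exists_fixed_point_of_prime_dvd_card_of_fixed_point A hdvd h1
  exact ⟨a, hne.symm, fun x hx => ha ⟨φ x, Subgroup.mem_map_of_mem φ hx⟩⟩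

/-- derived length bound for odd order solvable linear groups of dimension at most `m` -/
def LIN (m : ℕ) : Prop :=
  ∀ (p : ℕ) [Fact p.Prime] (K : Type) [Field K] [IsAlgClosed K] [CharP K p]
    (H V : Type u) [Group H] [Finite H] [AddCommGroup V] [Module K V] [FiniteDimensional K V]
    (_ : Group.IsSolvable H) (_ : Odd (Nat.card H)) (ρ : H →* Module.End K V),
    Module.finrank K V ≤ m → ∀ x ∈ ds (⊤ : Subgroup H) (gl m), ∃ j : ℕ, ρ x ^ (p ^ j) = 1

section
variable {Q A : Type u} [Group Q] [CommGroup A]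

theorem exists_rep_aux {r b : ℕ} (hr : r.Prime)
    (hcard : Nat.card A = r ^ b) (φ : Q →* MulAut A) [Module (ZMod r) (Additive A)] :
    ∃ (ρ : Q →* Module.End (ZMod r) (Additive A)),
      Module.Finite (ZMod r) (Additive A) ∧ Module.finrank (ZMod r) (Additive A) = b ∧
      ∀ x, (φ x = 1 ↔ ρ x = 1) := by
  have := Fact.mk hr
  have hf : Finite A := Nat.finite_of_card_ne_zero (by rw [hcard]; exact pow_ne_zero _ hr.ne_zero)
  have hfin : Module.Finite (ZMod r) (Additive A) :=
    Module.Finite.of_finite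
  let τ : Q → Module.End (ZMod r) (Additive A) :=
    fun x => AddMonoidHom.toZModLinearMap r ((φ x).toMonoidHom.toAdditive)
  have hτ : ∀ x a, τ x a = Additive.ofMul (φ x a.toMul) := fun x a => rfl
  let ρ : Q →* Module.End (ZMod r) (Additive A) :=
    { toFun := τ
      map_one' := by
        refine LinearMap.ext fun a => ?_
        rw [hτ, map_one]; rfl
      map_mul' := by
        intro x y
        refine LinearMap.ext fun a => ?_
        rw [hτ, map_mul]; rfl }
  refine ⟨ρ, hfin, ?_, ?_⟩
  · have h1 := Module.natCard_eq_pow_finrank (K := ZMod r) (V := Additive A)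
    have h2 : Nat.card (Additive A) = r ^ b := hcard
    rw [h2, Nat.card_zmod] at h1
    exact (Nat.pow_right_injective hr.two_le h1).symm
  · intro x
    constructor
    · intro h
      refine LinearMap.ext fun a => ?_
      change τ x a = _
      rw [hτ, h]; rfl
    · intro h; ext a
      have := LinearMap.congr_fun h (Additive.ofMul a)
      exact congrArg Additive.toMul this

theorem exists_rep {r b : ℕ} (hr : r.Prime) (hexp : ∀ a : A, a ^ r = 1)
    (hcard : Nat.card A = r ^ b) (φ : Q →* MulAut A) :
    ∃ (_ : Module (ZMod r) (Additive A)) (ρ : Q →* Module.End (ZMod r) (Additive A)),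
      Module.Finite (ZMod r) (Additive A) ∧ Module.finrank (ZMod r) (Additive A) = b ∧
      ∀ x, (φ x = 1 ↔ ρ x = 1) := by
  let inst : Module (ZMod r) (Additive A) := AddCommGroup.zmodModule (n := r) (by
    intro x
    exact hexp x.toMul)
  exact ⟨inst, exists_rep_aux hr hcard φ⟩

theorem el_abs [Finite Q] (hs : Group.IsSolvable Q) (hodd : Odd (Nat.card Q)) {r b : ℕ}
    (hr : r.Prime) (hexp : ∀ a : A, a ^ r = 1)
    (hcard : Nat.card A = r ^ b) (φ : Q →* MulAut A) (hL : LIN.{u} b) :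
    ∀ x ∈ ds (⊤ : Subgroup Q) (gl b), ∃ j : ℕ, φ x ^ (r ^ j) = 1 := by
  have := Fact.mk hr
  obtain ⟨_, ρ, hfin, hrank, hρ⟩ := exists_rep hr hexp hcard φ
  let K := AlgebraicClosure (ZMod r)
  let B := Module.End.baseChangeHom (ZMod r) K (Additive A)
  have hB : Function.Injective B := LinearMap.baseChangeHom_injective (ZMod r) (Additive A) K
  have := hL r K Q (K ⊗[ZMod r] Additive A) hs hodd ((B : _ →* _).comp ρ)
    (by rw [Module.finrank_baseChange, hrank])
  intro x hx
  obtain ⟨j, hj⟩ := this x hx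
  refine ⟨j, ?_⟩
  rw [← map_pow, hρ]
  apply hB
  rw [map_one, ← hj, map_pow, map_pow]
  rfl

theorem gl_abs [Finite Q] (hodd : Odd (Nat.card Q)) {r b : ℕ}
    (hr : r.Prime) (hexp : ∀ a : A, a ^ r = 1)
    (hcard : Nat.card A = r ^ b) (φ : Q →* MulAut A)
    (h : (r = 3 ∧ b = 1) ∨ (r = 5 ∧ b = 1) ∨ (r = 3 ∧ b = 2)) :
    ∀ x, φ x ^ r = 1 := by
  have := Fact.mk hr
  obtain ⟨_, ρ, hfin, hrank, hρ⟩ := exists_rep hr hexp hcard φ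
  let e := (Module.finBasisOfFinrankEq (ZMod r) (Additive A) hrank)
  let f := LinearMap.toMatrixAlgEquiv e
  let σ : Q →* GL (Fin b) (ZMod r) := ((f : _ →* _).comp ρ).toHomUnits
  have hσ : ∀ y, σ y = 1 → φ y = 1 := by
    intro y hy
    rw [hρ]
    apply f.injective
    rw [map_one]
    exact congrArg Units.val hy
  intro x
  rw [← map_pow]
  apply hσ
  have h1 : σ x ^ Nat.card (GL (Fin b) (ZMod r)) = 1 := pow_card_eq_one'
  have h2 : σ x ^ Nat.card Q = 1 := by rw [← map_pow, pow_card_eq_one', map_one]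
  have h3 := pow_gcd_eq_one.mpr ⟨h1, h2⟩
  have hg : Odd (Nat.gcd (Nat.card (GL (Fin b) (ZMod r))) (Nat.card Q)) :=
    Odd.of_dvd_nat hodd (Nat.gcd_dvd_right _ _)
  have hg2 := Nat.gcd_dvd_left (Nat.card (GL (Fin b) (ZMod r))) (Nat.card Q)
  rw [map_pow]
  rw [Matrix.card_GL_field, ZMod.card] at h3 hg hg2
  have key : ∀ g : ℕ, Odd g → g ∣ 16 * r → g.Coprime 16 := by
    intro g hg _
    have : Nat.Coprime g 2 := hg.coprime_two_right
    exact Nat.Coprime.pow_right 4 this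
  have fin : ∀ g : ℕ, Odd g → g ∣ 16 * r → σ x ^ g = 1 → σ x ^ r = 1 := by
    intro g hg hd hx
    obtain ⟨c, hc⟩ := (key g hg hd).dvd_of_dvd_mul_left hd
    have h5 : orderOf (σ x) ∣ r := (orderOf_dvd_of_pow_eq_one hx).trans ⟨c, hc⟩
    exact orderOf_dvd_iff_pow_eq_one.mp h5
  refine fin _ hg (hg2.trans ?_) h3
  rcases h with ⟨rfl, rfl⟩ | ⟨rfl, rfl⟩ | ⟨rfl, rfl⟩
  · simp
  · simp
  · simp [Fin.prod_univ_two]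

end

section
variable {Q : Type u} [Group Q]

theorem conjNormal_eq_one_iff (N : Subgroup Q) [N.Normal] (x : Q) :
    (MulAut.conjNormal x : MulAut N) = 1 ↔ ∀ n ∈ N, x * n = n * x := by
  constructor
  · intro h n hn
    have := congrArg (fun f : MulAut N => ((f ⟨n, hn⟩ : N) : Q)) h
    simp only [MulAut.conjNormal_apply, MulAut.one_apply] at this
    rw [mul_inv_eq_iff_eq_mul] at this
    exact this
  · intro h
    ext n
    simp only [MulAut.conjNormal_apply, MulAut.one_apply]
    rw [mul_inv_eq_iff_eq_mul]
    exact h n n.2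

theorem el_normal [Finite Q] (hs : Group.IsSolvable Q) (hodd : Odd (Nat.card Q)) {r b : ℕ}
    (hr : r.Prime) (N : Subgroup Q) [N.Normal] (hexp : ∀ x ∈ N, x ^ r = 1)
    (hc : ∀ x ∈ N, ∀ y ∈ N, x * y = y * x)
    (hcard : Nat.card N = r ^ b) (hL : LIN.{u} b) :
    ∀ x ∈ ds (⊤ : Subgroup Q) (gl b), ∃ j : ℕ, ∀ n ∈ N, x ^ (r ^ j) * n = n * x ^ (r ^ j) := by
  let _ : CommGroup N := { (inferInstance : Group N) with
    mul_comm := fun a b => Subtype.ext (hc a a.2 b b.2) }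
  intro x hx
  obtain ⟨j, hj⟩ := el_abs hs hodd hr (fun a : N => Subtype.ext (hexp a a.2)) hcard
    (MulAut.conjNormal) hL x hx
  refine ⟨j, ?_⟩
  rw [← conjNormal_eq_one_iff, map_pow, hj]

theorem irr_normal [Finite Q] (hs : Group.IsSolvable Q) (hodd : Odd (Nat.card Q)) {r b : ℕ}
    (hr : r.Prime) (N : Subgroup Q) [N.Normal] (hexp : ∀ x ∈ N, x ^ r = 1)
    (hc : ∀ x ∈ N, ∀ y ∈ N, x * y = y * x) (hb : 1 ≤ b)
    (hcard : Nat.card N = r ^ b)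
    (hmin : ∀ M : Subgroup Q, M.Normal → M ≤ N → M = ⊥ ∨ M = N) :
    (LIN.{u} b → ∀ x ∈ ds (⊤ : Subgroup Q) (gl b), ∀ n ∈ N, x * n = n * x) ∧
    ((r = 3 ∧ b = 1) ∨ (r = 5 ∧ b = 1) ∨ (r = 3 ∧ b = 2) →
      ∀ x, ∀ n ∈ N, x * n = n * x) := by
  let _ : CommGroup N := { (inferInstance : Group N) with
    mul_comm := fun a b => Subtype.ext (hc a a.2 b b.2) }
  have key : ∀ R : Subgroup Q, R.Normal →
      (∀ x ∈ R, ∃ j, (MulAut.conjNormal x : MulAut N) ^ (r ^ j) = 1) →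
      ∀ x ∈ R, ∀ n ∈ N, x * n = n * x := by
    intro R hRn hR
    obtain ⟨a, ha1, ha⟩ := fix_abs hr hb hcard MulAut.conjNormal R hR
    have hM : (Subgroup.centralizer (R : Set Q) ⊓ N).Normal := inferInstance
    have hmem : (a : Q) ∈ Subgroup.centralizer (R : Set Q) ⊓ N := by
      refine Subgroup.mem_inf.mpr ⟨Subgroup.mem_centralizer_iff.mpr ?_, a.2⟩
      intro x hx
      have := congrArg Subtype.val (ha x hx)
      rw [MulAut.conjNormal_apply, mul_inv_eq_iff_eq_mul] at this
      exact this
    rcases hmin _ hM inf_le_right with h | h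
    · rw [h, Subgroup.mem_bot] at hmem
      exact absurd (Subtype.ext hmem) ha1
    · intro x hx n hn
      rw [← h] at hn
      exact Subgroup.mem_centralizer_iff.mp hn.1 x hx
  constructor
  · intro hL
    refine key _ (ds_normal ⊤ _) ?_
    exact el_abs hs hodd hr (fun a : N => Subtype.ext (hexp a a.2)) hcard
      (MulAut.conjNormal) hL
  · intro h x n hn
    refine key ⊤ inferInstance ?_ x trivial n hn
    intro y _
    refine ⟨1, ?_⟩
    rw [pow_one]
    exact gl_abs hodd hr (fun a : N => Subtype.ext (hexp a a.2)) hcard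
      (MulAut.conjNormal) h y

end

section
/-- derived length bound for odd order solvable permutation groups of degree `s` -/
def PERM (s : ℕ) : Prop :=
  ∀ (P X : Type u) [Group P] [Finite P] [Finite X] [MulAction P X],
    Group.IsSolvable P → Odd (Nat.card P) → Nat.card X = s →
    ∀ x ∈ ds (⊤ : Subgroup P) (hp s), ∀ y : X, x • y = y

theorem solvable_sub {P : Type*} [Group P] (hs : Group.IsSolvable P) (C : Subgroup P) :
    Group.IsSolvable C := by
  infer_instance

theorem solvable_quot {P : Type*} [Group P] (hs : Group.IsSolvable P) (C : Subgroup P) [C.Normal] :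
    Group.IsSolvable (P ⧸ C) := by
  infer_instance

theorem odd_sub {P : Type*} [Group P] (ho : Odd (Nat.card P)) (C : Subgroup P) :
    Odd (Nat.card C) := Odd.of_dvd_nat ho C.card_subgroup_dvd_card

theorem odd_quot {P : Type*} [Group P] (ho : Odd (Nat.card P)) (C : Subgroup P) :
    Odd (Nat.card (P ⧸ C)) := Odd.of_dvd_nat ho C.card_quotient_dvd_card

variable {P X : Type u} [Group P] [Finite P] [Finite X] [MulAction P X]

theorem perm_sub {s : ℕ} (hP : PERM.{u} s) (hs : Group.IsSolvable P) (ho : Odd (Nat.card P))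
    (C : Subgroup P) (B : Set X) (hB : ∀ c ∈ C, ∀ b ∈ B, c • b ∈ B) (hcard : Nat.card B = s) :
    ∀ x ∈ ds C (hp s), ∀ y ∈ B, x • y = y := by
  intro x hx y hy
  let S : SubMulAction C X :=
    { carrier := B
      smul_mem' := fun c b hb => hB c c.2 b hb }
  rw [← ds_subtype, Subgroup.mem_map] at hx
  obtain ⟨z, hz, rfl⟩ := hx
  have := hP C S (solvable_sub hs C) (odd_sub ho C) hcard z hz ⟨y, hy⟩
  exact congrArg Subtype.val this

open scoped Pointwise in
theorem perm_step {M s : ℕ} (hL : ∀ b < M, LIN.{u} b) (hsM : s ≤ M)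
    (ih : ∀ t < s, PERM.{u} t) (hs : Group.IsSolvable P) (ho : Odd (Nat.card P))
    (hX : Nat.card X = s) [FaithfulSMul P X] [MulAction.IsPretransitive P X] :
    ∀ x ∈ ds (⊤ : Subgroup P) (hp s), ∀ y : X, x • y = y := by
  intro x hx y
  by_cases htop : (⊤ : Subgroup P) = ⊥
  · have : x ∈ (⊤ : Subgroup P) := trivial
    rw [htop, Subgroup.mem_bot] at this
    rw [this, one_smul]
  obtain ⟨N, hN, -, hN1, hmin, r, hr, hexp, hcomm, b, hb, hcard⟩ :=
    exists_min_normal hs ⊤ htop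
  have hr2 : r ≠ 2 := by
    rintro rfl
    have h1 : 2 ∣ Nat.card P := (dvd_pow_self 2 (by omega)).trans
      (hcard ▸ N.card_subgroup_dvd_card)
    have := Odd.of_dvd_nat ho h1
    revert this; decide
  have hr3 : 3 ≤ r := by have := hr.two_le; omega
  by_cases htr : ∀ z : X, ∃ n ∈ N, n • y = z
  · have fixall : ∀ g : P, (∀ n ∈ N, g * n = n * g) → g • y = y → g = 1 := by
      intro g hg hy
      apply FaithfulSMul.eq_of_smul_eq_smul (α := X)
      intro z
      obtain ⟨n, hn, rfl⟩ := htr z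
      rw [one_smul, ← mul_smul, hg n hn, mul_smul, hy]
    have inN : ∀ g : P, (∀ n ∈ N, g * n = n * g) → g ∈ N := by
      intro g hg
      obtain ⟨n, hn, hny⟩ := htr (g • y)
      have : n⁻¹ * g = 1 := by
        apply fixall
        · intro k hk
          rw [mul_assoc, hg k hk, ← mul_assoc, ← mul_assoc, hcomm _ (inv_mem hn) k hk]
        · rw [mul_smul, ← hny, inv_smul_smul]
      rw [inv_mul_eq_one] at this
      exact this ▸ hn
    have hbij : Function.Bijective (fun n : N => (n : P) • y) := by
      constructor
      · intro n n' h
        have : (n' : P)⁻¹ * n = 1 := by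
          apply fixall
          · intro k hk
            exact hcomm _ (mul_mem (inv_mem n'.2) n.2) k hk
          · rw [mul_smul]
            change (n : P) • y = (n' : P) • y at h
            rw [h, inv_smul_smul]
        rw [inv_mul_eq_one] at this
        exact Subtype.ext this.symm
      · intro z
        obtain ⟨n, hn, h⟩ := htr z
        exact ⟨⟨n, hn⟩, h⟩
    have hsN : s = r ^ b := by rw [← hX, ← hcard, Nat.card_eq_of_bijective _ hbij]
    have hbs : b < r ^ b := Nat.lt_pow_self hr.one_lt
    obtain ⟨h1, h2⟩ := irr_normal hs ho hr N hexp hcomm hb hcard hmin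
    have hNN : ds N 1 = ⊥ := by
      rw [ds_succ, ds_zero, Subgroup.commutator_eq_bot_iff_le_centralizer]
      intro g hg
      exact Subgroup.mem_centralizer_iff.mpr fun k hk => hcomm k hk g hg
    suffices hk : ∃ k, k + 1 ≤ hp s ∧ ds (⊤ : Subgroup P) k ≤ N by
      obtain ⟨k, hk, hkN⟩ := hk
      have h3 := ds_anti (⊤ : Subgroup P) hk hx
      rw [ds_add] at h3
      have h4 := ds_mono hkN 1 h3
      rw [hNN, Subgroup.mem_bot] at h4
      rw [h4, one_smul]
    by_cases hsp : b = 1 ∧ ¬ 7 ≤ r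
    · refine ⟨0, ?_, ?_⟩
      · have : hp 3 ≤ hp s := hp_mono (by rw [hsN, hsp.1, pow_one]; exact hr3)
        have := hp_three
        omega
      · intro g _
        apply inN
        have := prime_odd_cases hr hr2
        exact h2 (by omega) g
    · refine ⟨gl b, ?_, ?_⟩
      · rw [hsN, add_comm]
        exact arith_perm hr3 hb (by tauto)
      · intro g hg
        apply inN
        exact h1 (hL b (by omega)) g hg
  · let B : Set X := MulAction.orbit N y
    have hBl : MulAction.IsBlock P B := MulAction.IsBlock.orbit_of_normal y
    have hyB : y ∈ B := MulAction.mem_orbit_self y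
    have hcnt := hBl.ncard_block_mul_ncard_orbit_eq ⟨y, hyB⟩
    have hBs : B.ncard < s := by
      rw [← hX]
      apply Set.ncard_lt_card
      intro h
      apply htr
      intro z
      have : z ∈ B := by rw [h]; trivial
      obtain ⟨n, hn⟩ := this
      exact ⟨n, n.2, hn⟩
    have hB2 : B.ncard ≠ 1 := by
      intro h
      rw [Set.ncard_eq_one] at h
      obtain ⟨w, hw⟩ := h
      have hfix : ∀ n ∈ N, n • y = y := by
        intro n hn
        have h1 : n • y ∈ B := ⟨⟨n, hn⟩, rfl⟩
        rw [hw] at h1 hyB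
        rw [Set.mem_singleton_iff] at h1 hyB
        rw [h1, hyB]
      apply hN1
      rw [eq_bot_iff]
      intro n hn
      rw [Subgroup.mem_bot]
      apply FaithfulSMul.eq_of_smul_eq_smul (α := X)
      intro z
      obtain ⟨g, rfl⟩ := MulAction.exists_smul_eq P y z
      have := hfix _ (hN.conj_mem n hn g⁻¹)
      rw [inv_inv, mul_smul, mul_smul, inv_smul_eq_iff] at this
      rw [this, one_smul]
    have hB0 : B.ncard ≠ 0 := by
      exact Set.ncard_ne_zero_of_mem hyB
    have ho0 : (MulAction.orbit P B).ncard ≠ 0 := by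
      exact Set.ncard_ne_zero_of_mem (MulAction.mem_orbit_self B)
    have hos : (MulAction.orbit P B).ncard < s := by
      rw [← hX, ← hcnt]
      have : 2 ≤ B.ncard := by omega
      nlinarith [Nat.pos_of_ne_zero ho0]
    set a := B.ncard with ha
    set c := (MulAction.orbit P B).ncard with hc
    have hfixB : ∀ g ∈ ds (⊤ : Subgroup P) (hp c), ∀ S ∈ MulAction.orbit P B, g • S = S := by
      intro g hg S hS
      refine perm_sub (ih c hos) hs ho ⊤ (MulAction.orbit P B) ?_ rfl g hg S hS
      intro k _ S hS
      exact (MulAction.mem_orbit_of_mem_orbit k hS)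
    have hx' : x ∈ ds (ds (⊤ : Subgroup P) (hp c)) (hp a) := by
      rw [← ds_add]
      refine ds_anti _ ?_ hx
      exact hp_mul ho0 hB0 (by rw [mul_comm, hcnt, hX])
    refine perm_sub (ih a hBs) hs ho _ B ?_ rfl x hx' y hyB
    intro k hk z hz
    have := hfixB k hk B (MulAction.mem_orbit_self B)
    rw [← this]
    exact Set.smul_mem_smul_set hz

end

theorem perm_of_lin {M : ℕ} (hL : ∀ b < M, LIN.{u} b) : ∀ s ≤ M, PERM.{u} s := by
  intro s
  induction s using Nat.strong_induction_on with
  | _ s ih =>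
  intro hsM P X _ _ _ _ hs ho hX x hx y
  by_cases htr : MulAction.orbit P y = Set.univ
  · have : MulAction.IsPretransitive P X := MulAction.isPretransitive_iff_base y |>.mpr (by
      intro z
      have : z ∈ MulAction.orbit P y := by rw [htr]; trivial
      exact this)
    let f := MulAction.toPermHom P X
    have hf : Function.Surjective f.rangeRestrict := f.rangeRestrict_surjective
    have hsR : Group.IsSolvable f.range := Group.isSolvable_of_surjective hf
    have hoR : Odd (Nat.card f.range) := Odd.of_dvd_nat ho (Subgroup.card_range_dvd f)
    have htR : MulAction.IsPretransitive f.range X := ⟨fun a b => by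
      obtain ⟨g, hg⟩ := MulAction.exists_smul_eq P a b
      exact ⟨⟨f g, g, rfl⟩, hg⟩⟩
    have := perm_step (P := f.range) (X := X) hL hsM (fun t ht => ih t ht (by omega)) hsR hoR hX
      (f.rangeRestrict x) (ds_hom f.rangeRestrict hx) y
    exact this
  · have hlt : (MulAction.orbit P y).ncard < s := by
      rw [← hX]; exact Set.ncard_lt_card htr
    refine perm_sub (ih _ hlt (by omega)) hs ho ⊤ (MulAction.orbit P y) ?_ rfl x
      (ds_anti _ (hp_mono hlt.le) hx) y (MulAction.mem_orbit_self y)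
    intro k _ S hS
    exact (MulAction.mem_orbit_of_mem_orbit k hS)

section
variable {K : Type} [Field K] {H V : Type u} [Group H]
  [AddCommGroup V] [Module K V]

theorem rho_inv_left (ρ : H →* Module.End K V) (h : H) (v : V) : ρ h⁻¹ (ρ h v) = v := by
  rw [← Module.End.mul_apply, ← map_mul, inv_mul_cancel, map_one, Module.End.one_apply]

theorem rho_mul (ρ : H →* Module.End K V) (g h : H) (v : V) : ρ (g * h) v = ρ g (ρ h v) := by
  rw [map_mul, Module.End.mul_apply]

theorem lin_sub [Finite H] [FiniteDimensional K V] [IsAlgClosed K]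
    {p : ℕ} [Fact p.Prime] [CharP K p] {m : ℕ} (hL : LIN.{u} m)
    (hs : Group.IsSolvable H) (ho : Odd (Nat.card H)) (ρ : H →* Module.End K V)
    (C : Subgroup H) (W : Submodule K V) (hW : ∀ c ∈ C, ∀ w ∈ W, ρ c w ∈ W)
    (hm : Module.finrank K W ≤ m) :
    ∀ x ∈ ds C (gl m), ∃ j : ℕ, ∀ w ∈ W, ρ (x ^ p ^ j) w = w := by
  let σ : C →* Module.End K W :=
    { toFun := fun c => (ρ c).restrict (hW c c.2)
      map_one' := by
        ext w
        simp [LinearMap.restrict_apply]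
      map_mul' := by
        intro a b
        ext w
        simp [LinearMap.restrict_apply] }
  intro x hx
  rw [← ds_subtype, Subgroup.mem_map] at hx
  obtain ⟨z, hz, rfl⟩ := hx
  obtain ⟨j, hj⟩ := hL p K C W (solvable_sub hs C) (odd_sub ho C) σ hm z hz
  refine ⟨j, ?_⟩
  intro w hw
  rw [← map_pow] at hj
  have := LinearMap.congr_fun hj ⟨w, hw⟩
  exact congrArg Subtype.val this

theorem lin_quot [Finite H] [FiniteDimensional K V] [IsAlgClosed K]
    {p : ℕ} [Fact p.Prime] [CharP K p] {m : ℕ} (hL : LIN.{u} m)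
    (hs : Group.IsSolvable H) (ho : Odd (Nat.card H)) (ρ : H →* Module.End K V)
    (W : Submodule K V) (hW : ∀ c, ∀ w ∈ W, ρ c w ∈ W)
    (hm : Module.finrank K (V ⧸ W) ≤ m) :
    ∀ x ∈ ds (⊤ : Subgroup H) (gl m), ∃ j : ℕ, ∀ v, ρ (x ^ p ^ j) v - v ∈ W := by
  let σ : H →* Module.End K (V ⧸ W) :=
    { toFun := fun c => W.mapQ W (ρ c) (hW c)
      map_one' := by
        refine LinearMap.ext fun v => ?_
        obtain ⟨v, rfl⟩ := W.mkQ_surjective v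
        simp
      map_mul' := by
        intro a b
        refine LinearMap.ext fun v => ?_
        obtain ⟨v, rfl⟩ := W.mkQ_surjective v
        simp }
  intro x hx
  obtain ⟨j, hj⟩ := hL p K H (V ⧸ W) hs ho σ hm x hx
  refine ⟨j, ?_⟩
  intro v
  rw [← map_pow] at hj
  have h2 := LinearMap.congr_fun hj (W.mkQ v)
  have h3 : W.mkQ (ρ (x ^ p ^ j) v) = W.mkQ v := h2
  exact (Submodule.Quotient.eq W).mp h3

theorem unip {p : ℕ} [CharP K p] (y : Module.End K V) (W : Submodule K V)
    (h1 : ∀ w ∈ W, y w = w) (h2 : ∀ v, y v - v ∈ W) : y ^ p = 1 := by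
  have key : ∀ n : ℕ, ∀ v, (y ^ n) v = v + (n : K) • (y v - v) := by
    intro n
    induction n with
    | zero => intro v; simp
    | succ n ih =>
      intro v
      rw [pow_succ', Module.End.mul_apply, ih, map_add, map_smul, h1 _ (h2 v)]
      push_cast
      rw [add_smul, one_smul]
      abel
  refine LinearMap.ext fun v => ?_
  rw [key, CharP.cast_eq_zero, zero_smul, add_zero, Module.End.one_apply]

theorem lin_red [Finite H] [FiniteDimensional K V] [IsAlgClosed K]
    {p : ℕ} [Fact p.Prime] [CharP K p] {m : ℕ} (hL : ∀ b < m, LIN.{u} b)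
    (hs : Group.IsSolvable H) (ho : Odd (Nat.card H)) (ρ : H →* Module.End K V)
    (W : Submodule K V) (hW : ∀ c, ∀ w ∈ W, ρ c w ∈ W)
    (hm : Module.finrank K V ≤ m) (hb : W ≠ ⊥) (ht : W ≠ ⊤) :
    ∀ x ∈ ds (⊤ : Subgroup H) (gl m), ∃ j : ℕ, ρ x ^ p ^ j = 1 := by
  intro x hx
  have e := W.finrank_quotient_add_finrank
  have h0 : 0 < Module.finrank K W := by
    rw [Nat.pos_iff_ne_zero, Ne, Submodule.finrank_eq_zero]; exact hb
  have h1 : Module.finrank K W < Module.finrank K V := Submodule.finrank_lt ht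
  obtain ⟨j, hj⟩ := lin_sub (p := p) (hL _ (h1.trans_le hm)) hs ho ρ ⊤ W (fun c _ => hW c) le_rfl x
    (ds_anti _ (gl_mono (by omega)) hx)
  obtain ⟨i, hi⟩ := lin_quot (p := p) (hL (Module.finrank K (V ⧸ W)) (by omega)) hs ho ρ W hW le_rfl x
    (ds_anti _ (gl_mono (by omega)) hx)
  have fix1 : ∀ w ∈ W, ρ (x ^ p ^ (j + i)) w = w := by
    have : ∀ n : ℕ, ∀ w ∈ W, ρ ((x ^ p ^ j) ^ n) w = w := by
      intro n
      induction n with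
      | zero => intro w _; simp
      | succ n ih => intro w hw; rw [pow_succ, rho_mul, hj w hw, ih w hw]
    rw [pow_add, pow_mul]
    exact this _
  have fix2 : ∀ v, ρ (x ^ p ^ (j + i)) v - v ∈ W := by
    have : ∀ n : ℕ, ∀ v, ρ ((x ^ p ^ i) ^ n) v - v ∈ W := by
      intro n
      induction n with
      | zero => intro w; simp
      | succ n ih =>
        intro v
        rw [pow_succ, rho_mul]
        have := W.add_mem (ih (ρ (x ^ p ^ i) v)) (hi v)
        rwa [sub_add_sub_cancel] at this
    rw [add_comm, pow_add, pow_mul]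
    exact this _
  refine ⟨j + i + 1, ?_⟩
  rw [pow_succ, pow_mul, ← map_pow]
  exact unip _ W fix1 fix2

/-- irreducibility -/
def Irr (ρ : H →* Module.End K V) : Prop :=
  ∀ W : Submodule K V, (∀ h, ∀ w ∈ W, ρ h w ∈ W) → W = ⊥ ∨ W = ⊤

theorem lin_tr [Finite H] [FiniteDimensional K V] [IsAlgClosed K]
    {p : ℕ} [Fact p.Prime] [CharP K p] {m : ℕ} (hL : LIN.{u} m)
    (hs : Group.IsSolvable H) (ho : Odd (Nat.card H)) (ρ : H →* Module.End K V) (hirr : Irr ρ)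
    (C : Subgroup H) [C.Normal] (W : Submodule K V) (hW : ∀ c ∈ C, ∀ w ∈ W, ρ c w ∈ W)
    (hm : Module.finrank K W ≤ m) (hW0 : W ≠ ⊥) :
    ∀ x ∈ ds C (gl m), ∃ j : ℕ, ρ x ^ p ^ j = 1 := by
  intro x hx
  have hn := ds_normal C (gl m)
  have h1 : ∀ h : H, ∃ j : ℕ, ∀ w ∈ W, ρ ((h⁻¹ * x * h) ^ p ^ j) w = w := by
    intro h
    apply lin_sub hL hs ho ρ C W hW hm
    have := hn.conj_mem x hx h⁻¹
    rwa [inv_inv] at this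
  choose j hj using h1
  obtain ⟨J, hJ⟩ : ∃ J, ∀ h, j h ≤ J := by
    obtain ⟨J, hJ⟩ := (Set.finite_range j).bddAbove
    exact ⟨J, fun h => hJ ⟨h, rfl⟩⟩
  let U : Submodule K V :=
    { carrier := {v | ∀ h, ρ ((h⁻¹ * x * h) ^ p ^ J) v = v}
      zero_mem' := by intro h; simp
      add_mem' := by
        intro a b ha hb h
        rw [map_add, ha h, hb h]
      smul_mem' := by
        intro c a ha h
        rw [map_smul, ha h] }
  have hWU : W ≤ U := by
    intro w hw h
    have : ∀ n : ℕ, ρ (((h⁻¹ * x * h) ^ p ^ j h) ^ n) w = w := by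
      intro n
      induction n with
      | zero => simp
      | succ n ih => rw [pow_succ, rho_mul, hj h w hw, ih]
    obtain ⟨i, hi⟩ := Nat.exists_eq_add_of_le (hJ h)
    rw [hi, pow_add, pow_mul]
    exact this _
  have hU : ∀ g, ∀ v ∈ U, ρ g v ∈ U := by
    intro g v hv h
    have h2 := hv (h * g)
    have h3 : ((h⁻¹ * x * h) ^ p ^ J) * g = g * (((h * g)⁻¹ * x * (h * g)) ^ p ^ J) := by
      have : (h * g)⁻¹ * x * (h * g) = g⁻¹ * (h⁻¹ * x * h) * g⁻¹⁻¹ := by group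
      rw [this, conj_pow]; group
    rw [← rho_mul, h3, rho_mul, h2]
  rcases hirr U hU with h | h
  · rw [h, le_bot_iff] at hWU
    exact absurd hWU hW0
  · refine ⟨J, LinearMap.ext fun v => ?_⟩
    have : v ∈ U := by rw [h]; trivial
    have := this 1
    simp only [inv_one, one_mul, mul_one] at this
    rw [← map_pow, this, Module.End.one_apply]

/-- weight spaces -/
def wt (ρ : H →* Module.End K V) (B : Subgroup H) (χ : B → K) : Submodule K V :=
  ⨅ a : B, Module.End.eigenspace (ρ a) (χ a)

theorem mem_wt {ρ : H →* Module.End K V} {B : Subgroup H} {χ : B → K} {v : V} :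
    v ∈ wt ρ B χ ↔ ∀ a : B, ρ a v = χ a • v := by
  simp [wt, Submodule.mem_iInf]

theorem exists_wt [FiniteDimensional K V] [IsAlgClosed K] [Nontrivial V]
    (ρ : H →* Module.End K V) (B : Subgroup H) (hB : ∀ x ∈ B, ∀ y ∈ B, x * y = y * x) :
    ∃ χ : B → K, wt ρ B χ ≠ ⊥ := by
  have key : ∀ n : ℕ, ∀ W : Submodule K V, Module.finrank K W = n → W ≠ ⊥ →
      (∀ a ∈ B, ∀ w ∈ W, ρ a w ∈ W) → ∃ χ : B → K, wt ρ B χ ≠ ⊥ := by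
    intro n
    induction n using Nat.strong_induction_on with
    | _ n ih =>
    intro W hn hW0 hW
    by_cases hsc : ∀ a : B, ∃ μ : K, ∀ w ∈ W, ρ a w = μ • w
    · choose χ hχ using hsc
      refine ⟨χ, fun h => hW0 ?_⟩
      rw [← le_bot_iff, ← h]
      intro w hw
      exact mem_wt.mpr fun a => hχ a w hw
    · push Not at hsc
      obtain ⟨a, ha⟩ := hsc
      have : Nontrivial W := Submodule.nontrivial_iff_ne_bot.mpr hW0
      obtain ⟨μ, hμ⟩ := Module.End.exists_eigenvalue ((ρ a).restrict (hW a a.2))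
      obtain ⟨v, hv⟩ := hμ.exists_hasEigenvector
      have hv1 : ρ a v = μ • (v : V) := congrArg Subtype.val hv.apply_eq_smul
      obtain ⟨w, hw, hne⟩ := ha μ
      let W' := W ⊓ Module.End.eigenspace (ρ a) μ
      have hlt : W' < W := by
        refine lt_of_le_of_ne inf_le_left fun h => hne ?_
        rw [← h] at hw
        exact Module.End.mem_eigenspace_iff.mp hw.2
      refine ih (Module.finrank K W') ?_ W' rfl ?_ ?_
      · rw [← hn]; exact Submodule.finrank_lt_finrank_of_lt hlt
      · intro h
        have : (v : V) ∈ W' := ⟨v.2, Module.End.mem_eigenspace_iff.mpr hv1⟩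
        rw [h, Submodule.mem_bot] at this
        exact hv.2 (Subtype.ext this)
      · intro c hc w hw
        refine ⟨hW c hc w hw.1, Module.End.mem_eigenspace_iff.mpr ?_⟩
        have h4 := Module.End.mem_eigenspace_iff.mp hw.2
        rw [← rho_mul, hB a a.2 c hc, rho_mul, h4, map_smul]
  exact key _ ⊤ rfl top_ne_bot (fun _ _ _ _ => trivial)

theorem wt_indep (ρ : H →* Module.End K V) (B : Subgroup H)
    (hB : ∀ x ∈ B, ∀ y ∈ B, x * y = y * x) : iSupIndep (fun χ : B → K => wt ρ B χ) := by
  have hmaps : ∀ (i j : B) (φ : K), Set.MapsTo (ρ i) ((ρ j).maxGenEigenspace φ)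
      ((ρ j).maxGenEigenspace φ) := by
    intro i j φ
    apply Module.End.mapsTo_maxGenEigenspace_of_comm
    change ρ j * ρ i = ρ i * ρ j
    rw [← map_mul, ← map_mul, hB j j.2 i i.2]
  have h1 : iSupIndep (fun χ : B → K => ⨅ a : B, (ρ a).maxGenEigenspace (χ a)) :=
    Module.End.independent_iInf_maxGenEigenspace_of_forall_mapsTo (fun a : B => ρ a) hmaps
  have h2 : (fun χ : B → K => wt ρ B χ) ≤ (fun χ : B → K => ⨅ a : B, (ρ a).maxGenEigenspace (χ a)) := by
    intro χ v hv
    rw [Submodule.mem_iInf]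
    intro a
    rw [Module.End.mem_maxGenEigenspace]
    refine ⟨1, ?_⟩
    rw [pow_one, LinearMap.sub_apply, mem_wt.mp hv a]
    simp
  exact h1.mono h2

theorem sum_finrank_le [FiniteDimensional K V] {ι : Type u} [Fintype ι] (W : ι → Submodule K V)
    (hW : iSupIndep W) : ∑ i, Module.finrank K (W i) ≤ Module.finrank K V := by
  classical
  rw [← Module.finrank_directSum]
  exact LinearMap.finrank_le_finrank_of_injective hW.dfinsupp_lsum_injective

/-- action on weights -/
abbrev wtAct (B : Subgroup H) [B.Normal] : MulAction H (B → K) where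
  smul h χ := fun a => χ (MulAut.conjNormal h⁻¹ a)
  one_smul χ := by
    funext a
    change χ (MulAut.conjNormal 1⁻¹ a) = χ a
    simp
  mul_smul g h χ := by
    funext a
    change χ (MulAut.conjNormal (g * h)⁻¹ a) =
      χ (MulAut.conjNormal h⁻¹ (MulAut.conjNormal g⁻¹ a))
    rw [mul_inv_rev, map_mul, MulAut.mul_apply]

theorem wtAct_smul (B : Subgroup H) [B.Normal] (h : H) (χ : B → K) (a : B) :
    ((wtAct B).toSMul.smul h χ) a = χ (MulAut.conjNormal h⁻¹ a) := rfl

theorem wt_map (ρ : H →* Module.End K V) (B : Subgroup H) [B.Normal] (h : H) (χ : B → K)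
    {v : V} (hv : v ∈ wt ρ B χ) : ρ h v ∈ wt ρ B ((wtAct B).toSMul.smul h χ) := by
  rw [mem_wt] at hv ⊢
  intro a
  rw [wtAct_smul]
  have h1 := hv (MulAut.conjNormal h⁻¹ a)
  rw [MulAut.conjNormal_apply, inv_inv] at h1
  have h2 : (a : H) * h = h * (h⁻¹ * a * h) := by group
  rw [← rho_mul, h2, rho_mul, h1, map_smul]

theorem orbit_dim [Finite H] [FiniteDimensional K V]
    (ρ : H →* Module.End K V) (B : Subgroup H) [B.Normal]
    (hB : ∀ x ∈ B, ∀ y ∈ B, x * y = y * x) (χ : B → K) :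
    let _ : MulAction H (B → K) := wtAct B
    Nat.card (MulAction.orbit H χ) * Module.finrank K (wt ρ B χ) ≤ Module.finrank K V := by
  intro _
  have hfin : Finite (MulAction.orbit H χ) := Set.finite_range _
  have := Fintype.ofFinite (MulAction.orbit H χ)
  have h1 := sum_finrank_le (fun ψ : MulAction.orbit H χ => wt ρ B (ψ : B → K))
    ((wt_indep ρ B hB).comp Subtype.val_injective)
  refine le_trans ?_ h1
  rw [Nat.card_eq_fintype_card, ← smul_eq_mul, ← Finset.card_univ]
  refine Finset.card_nsmul_le_sum _ _ _ ?_
  rintro ⟨ψ, h, rfl⟩ -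
  let f : wt ρ B χ →ₗ[K] wt ρ B ((wtAct B).toSMul.smul h χ) :=
    (ρ h).restrict (fun v hv => wt_map ρ B h χ hv)
  refine LinearMap.finrank_le_finrank_of_injective (f := f) ?_
  intro v w hvw
  have h3 : ρ h v = ρ h w := congrArg Subtype.val hvw
  apply Subtype.ext
  rw [← rho_inv_left ρ h v, h3, rho_inv_left]

end

section
variable {K : Type} [Field K] {H V : Type u} [Group H]
  [AddCommGroup V] [Module K V]

theorem scal_central (ρ : H →* Module.End K V) (hinj : Function.Injective ρ) (a : H) (μ : K)
    (h : ∀ v, ρ a v = μ • v) : a ∈ Subgroup.center H := by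
  rw [Subgroup.mem_center_iff]
  intro g
  apply hinj
  refine LinearMap.ext fun v => ?_
  rw [rho_mul, rho_mul, h, h, map_smul]

theorem inv_wt_scal (ρ : H →* Module.End K V) (hirr : Irr ρ) (A : Subgroup H)
    (χ : A → K) (hχ : wt ρ A χ ≠ ⊥) (hinv : ∀ h, ∀ v ∈ wt ρ A χ, ρ h v ∈ wt ρ A χ) :
    ∀ (a : A) v, ρ a v = χ a • v := by
  intro a v
  have h := (hirr _ hinv).resolve_left hχ
  have : v ∈ wt ρ A χ := by rw [h]; trivial
  exact mem_wt.mp this a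

theorem center_scal [FiniteDimensional K V] [IsAlgClosed K] [Nontrivial V]
    (ρ : H →* Module.End K V) (hirr : Irr ρ) (hinj : Function.Injective ρ) :
    ∃ l : Subgroup.center H →* K, Function.Injective l ∧
      ∀ (z : Subgroup.center H) v, ρ z v = l z • v := by
  obtain ⟨χ, hχ⟩ := exists_wt ρ (Subgroup.center H) (by
    intro x _ y hy
    exact Subgroup.mem_center_iff.mp hy x)
  have hs := inv_wt_scal ρ hirr _ χ hχ (by
    intro h v hv
    rw [mem_wt] at hv ⊢
    intro a
    rw [← rho_mul, ← Subgroup.mem_center_iff.mp a.2 h, rho_mul, hv a, map_smul])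
  obtain ⟨v, hv⟩ := exists_ne (0 : V)
  let l : Subgroup.center H →* K :=
    { toFun := χ
      map_one' := by
        have := hs 1 v
        rw [Subgroup.coe_one, map_one, Module.End.one_apply] at this
        have h2 : (1 : K) • v = χ 1 • v := by rw [one_smul]; exact this
        exact (smul_left_injective K hv h2).symm
      map_mul' := by
        intro a b
        have := hs (a * b) v
        rw [Subgroup.coe_mul, rho_mul, hs b, map_smul, hs a, smul_smul, mul_comm] at this
        exact (smul_left_injective K hv this).symm }
  refine ⟨l, ?_, hs⟩
  intro a b hab
  apply Subtype.ext
  apply hinj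
  refine LinearMap.ext fun w => ?_
  have : χ a = χ b := hab
  rw [hs, hs, this]

theorem lin_case1 [Finite H] [FiniteDimensional K V] [IsAlgClosed K] [Nontrivial V]
    {p : ℕ} [Fact p.Prime] [CharP K p] {m : ℕ} (hL : ∀ b < m, LIN.{u} b)
    (hs : Group.IsSolvable H) (ho : Odd (Nat.card H)) (ρ : H →* Module.End K V) (hirr : Irr ρ)
    (hinj : Function.Injective ρ) (hm : Module.finrank K V = m)
    (A : Subgroup H) [A.Normal] (hA : ∀ x ∈ A, ∀ y ∈ A, x * y = y * x)
    (hAc : ¬ A ≤ Subgroup.center H) :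
    ∀ x ∈ ds (⊤ : Subgroup H) (gl m), ∃ j : ℕ, ρ x ^ p ^ j = 1 := by
  obtain ⟨χ, hχ⟩ := exists_wt ρ A hA
  have hdim := orbit_dim ρ A hA χ
  let act : MulAction H (A → K) := wtAct A
  have hdim : Nat.card (MulAction.orbit H χ) * Module.finrank K (wt ρ A χ) ≤ m := hm ▸ hdim
  have hfin : Finite (MulAction.orbit H χ) := Set.finite_range _
  set s := Nat.card (MulAction.orbit H χ) with hsdef
  set m' := Module.finrank K (wt ρ A χ) with hm'
  have hm1 : 1 ≤ m' := by
    rw [Nat.one_le_iff_ne_zero, hm', Ne, Submodule.finrank_eq_zero]; exact hχ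
  have hne : Nonempty (MulAction.orbit H χ) := ⟨⟨χ, MulAction.mem_orbit_self χ⟩⟩
  have hs0 : s ≠ 0 := Nat.card_ne_zero.mpr ⟨hne, hfin⟩
  have hs2 : 2 ≤ s := by
    by_contra hlt
    have hs1 : s = 1 := by omega
    apply hAc
    have hsub := (Nat.card_eq_one_iff_unique.mp hs1).1
    intro a ha
    refine scal_central ρ hinj a (χ ⟨a, ha⟩) ?_
    refine inv_wt_scal ρ hirr A χ hχ ?_ ⟨a, ha⟩
    intro h v hv
    have h1 := wt_map ρ A h χ hv
    have h2 : h • χ = χ :=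
      congrArg Subtype.val (Subsingleton.elim (⟨h • χ, h, rfl⟩ : MulAction.orbit H χ)
        ⟨χ, MulAction.mem_orbit_self χ⟩)
    have h3 : (wtAct A).toSMul.smul h χ = χ := h2
    rwa [h3] at h1
  have hsm : s ≤ m := by nlinarith
  have hmm : m' < m := by nlinarith
  let C : Subgroup H := (MulAction.toPermHom H (MulAction.orbit H χ)).ker
  have hCn : C.Normal := inferInstance
  have hdsC : ds (⊤ : Subgroup H) (hp s) ≤ C := by
    intro g hg
    rw [MonoidHom.mem_ker]
    ext1 ψ
    exact perm_of_lin hL s hsm H (MulAction.orbit H χ) hs ho rfl g hg ψ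
  intro x hx
  have hx1 : x ∈ ds C (gl m') := by
    refine ds_mono hdsC _ ?_
    rw [← ds_add]
    exact ds_anti _ (arith_case1 hs2 hm1 hdim) hx
  refine lin_tr (hL m' hmm) hs ho ρ hirr C (wt ρ A χ) ?_ le_rfl hχ x hx1
  intro c hc v hv
  have h1 := wt_map ρ A c χ hv
  have h2 : c • χ = χ := by
    rw [MonoidHom.mem_ker] at hc
    have := congrArg (fun f : Equiv.Perm (MulAction.orbit H χ) =>
      (f ⟨χ, MulAction.mem_orbit_self χ⟩ : A → K)) hc
    exact this
  have h3 : (wtAct A).toSMul.smul c χ = χ := h2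
  rwa [h3] at h1

theorem card_hom_le {N : Type*} [Group N] [Finite N] :
    Finite (N →* K) ∧ Nat.card (N →* K) ≤ Nat.card N := by
  have := Fintype.ofFinite N
  have hl := linearIndependent_monoidHom N K
  have hf : Finite (N →* K) := hl.finite
  refine ⟨hf, ?_⟩
  have := Fintype.ofFinite (N →* K)
  have h := hl.fintype_card_le_finrank
  rwa [Module.finrank_pi, ← Nat.card_eq_fintype_card, ← Nat.card_eq_fintype_card] at h

theorem card_hom_triv_le {N : Type*} [Group N] [Finite N] (B : Subgroup N) [B.Normal] :
    Finite {f : N →* K // ∀ b ∈ B, f b = 1} ∧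
    Nat.card {f : N →* K // ∀ b ∈ B, f b = 1} ≤ B.index := by
  obtain ⟨hf, hc⟩ := card_hom_le (K := K) (N := N ⧸ B)
  let F : {f : N →* K // ∀ b ∈ B, f b = 1} → (N ⧸ B →* K) := fun f =>
    QuotientGroup.lift B f.1 (fun b hb => f.2 b hb)
  have hF : Function.Injective F := by
    intro f g h
    apply Subtype.ext
    ext n
    exact DFunLike.congr_fun h (n : N ⧸ B)
  refine ⟨Finite.of_injective F hF, ?_⟩
  exact (Nat.card_le_card_of_injective F hF).trans hc

end

section
variable {K : Type} [Field K] {H : Type u} [Group H]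

/-- commutator pairing -/
def pr (l : Subgroup.center H →* K) (N : Subgroup H) (h : H)
    (hD : ∀ n ∈ N, ⁅h, n⁆ ∈ Subgroup.center H) : N →* K where
  toFun n := l ⟨⁅h, (n : H)⁆, hD n n.2⟩
  map_one' := by
    rw [← map_one l]
    congr 1
    apply Subtype.ext
    simp
  map_mul' := by
    intro a b
    rw [← map_mul]
    congr 1
    apply Subtype.ext
    change ⁅h, (a : H) * b⁆ = ⁅h, (a : H)⁆ * ⁅h, (b : H)⁆
    have hb := Subgroup.mem_center_iff.mp (hD b b.2) a
    have h2 : ⁅h, (a : H) * b⁆ = ⁅h, (a : H)⁆ * (a * ⁅h, (b : H)⁆ * (a : H)⁻¹) := by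
      simp only [commutatorElement_def]; group
    rw [h2, hb, mul_inv_cancel_right]

theorem pr_inj (l : Subgroup.center H →* K) (hl : Function.Injective l) (N : Subgroup H) (h h' : H)
    (hD : ∀ n ∈ N, ⁅h, n⁆ ∈ Subgroup.center H) (hD' : ∀ n ∈ N, ⁅h', n⁆ ∈ Subgroup.center H)
    (heq : pr l N h hD = pr l N h' hD') : h'⁻¹ * h ∈ Subgroup.centralizer (N : Set H) := by
  rw [Subgroup.mem_centralizer_iff]
  intro n hn
  have h1 := DFunLike.congr_fun heq ⟨n, hn⟩
  have h2 : ⁅h, n⁆ = ⁅h', n⁆ := congrArg Subtype.val (hl h1)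
  simp only [commutatorElement_def, mul_left_inj] at h2
  have h3 : h'⁻¹ * (h * n * h⁻¹) * h = h'⁻¹ * (h' * n * h'⁻¹) * h := by rw [h2]
  have h4 : h'⁻¹ * (h * n * h⁻¹) * h = h'⁻¹ * h * n := by group
  have h5 : h'⁻¹ * (h' * n * h'⁻¹) * h = n * (h'⁻¹ * h) := by group
  rw [← h5, ← h3, h4]

theorem pr_map (l : Subgroup.center H →* K) (hl : Function.Injective l) (N : Subgroup H)
    (hNN : ∀ x ∈ N, ∀ y ∈ N, ⁅x, y⁆ ∈ Subgroup.center H)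
    (hcN : Subgroup.centralizer (N : Set H) ⊓ N ≤ Subgroup.center H)
    (B E : Subgroup H) (hBN : B ≤ N) (hBE : ∀ b ∈ B, ∀ e ∈ E, b * e = e * b) :
    ∃ Φ : B ⧸ (Subgroup.center H).subgroupOf B → {f : N →* K // ∀ e ∈ E.subgroupOf N, f e = 1},
      Function.Injective Φ ∧ ∀ q, ∃ b, ∃ hb : b ∈ B,
        (Φ q).1 = pr l N b (fun n hn => hNN b (hBN hb) n hn) := by
  let Φ : B ⧸ (Subgroup.center H).subgroupOf B → {f : N →* K // ∀ e ∈ E.subgroupOf N, f e = 1} :=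
    fun q => ⟨pr l N q.out (fun n hn => hNN _ (hBN q.out.2) n hn), by
      intro e he
      rw [Subgroup.mem_subgroupOf] at he
      change l ⟨⁅(q.out : H), (e : H)⁆, _⟩ = 1
      rw [← map_one l]
      congr 1
      apply Subtype.ext
      change ⁅(q.out : H), (e : H)⁆ = 1
      rw [commutatorElement_eq_one_iff_mul_comm]
      exact hBE _ q.out.2 e he⟩
  refine ⟨Φ, ?_, fun q => ⟨q.out, q.out.2, rfl⟩⟩
  intro q q' h
  have h1 := pr_inj l hl N _ _ (fun n hn => hNN _ (hBN q.out.2) n hn)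
    (fun n hn => hNN _ (hBN q'.out.2) n hn) (congrArg Subtype.val h)
  have h2 : (q'.out : H)⁻¹ * q.out ∈ Subgroup.center H := hcN ⟨h1, hBN
    (mul_mem (inv_mem q'.out.2) q.out.2)⟩
  rw [← q.out_eq', ← q'.out_eq', eq_comm]
  exact QuotientGroup.eq.mpr h2

theorem normal_subgroupOf (N : Subgroup H)
    (hNN : ∀ x ∈ N, ∀ y ∈ N, ⁅x, y⁆ ∈ Subgroup.center H)
    (B : Subgroup H) (hB : Subgroup.center H ≤ B) : (B.subgroupOf N).Normal := by
  constructor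
  intro b hb n
  rw [Subgroup.mem_subgroupOf] at hb ⊢
  have : ((n * b * n⁻¹ : N) : H) = ⁅(n : H), (b : H)⁆ * b := by
    rw [commutatorElement_def]; push_cast; group
  rw [this]
  exact mul_mem (hB (hNN n n.2 b b.2)) hb

theorem index_le [Finite H] (l : Subgroup.center H →* K) (hl : Function.Injective l)
    (N : Subgroup H) (hNN : ∀ x ∈ N, ∀ y ∈ N, ⁅x, y⁆ ∈ Subgroup.center H)
    (hcN : Subgroup.centralizer (N : Set H) ⊓ N ≤ Subgroup.center H)
    (B : Subgroup H) (hBN : B ≤ N) (hZB : Subgroup.center H ≤ B)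
    (hBB : ∀ x ∈ B, ∀ y ∈ B, x * y = y * x) :
    (Subgroup.center H).relIndex B ≤ B.relIndex N := by
  obtain ⟨Φ, hΦ, -⟩ := pr_map l hl N hNN hcN B B hBN hBB
  have := normal_subgroupOf N hNN B hZB
  obtain ⟨hf, hc⟩ := card_hom_triv_le (K := K) (B.subgroupOf N)
  exact (Nat.card_le_card_of_injective Φ hΦ).trans hc

theorem mem_sup_centralizer [Finite H] (l : Subgroup.center H →* K) (hl : Function.Injective l)
    (N : Subgroup H) (hNN : ∀ x ∈ N, ∀ y ∈ N, ⁅x, y⁆ ∈ Subgroup.center H)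
    (hcN : Subgroup.centralizer (N : Set H) ⊓ N ≤ Subgroup.center H)
    (h : H) (hD : ∀ n ∈ N, ⁅h, n⁆ ∈ Subgroup.center H) :
    h ∈ N ⊔ Subgroup.centralizer (N : Set H) := by
  obtain ⟨Φ, hΦ, hΦ2⟩ := pr_map l hl N hNN hcN N (Subgroup.center H) le_rfl
    (fun b _ e he => Subgroup.mem_center_iff.mp he b)
  have := normal_subgroupOf N hNN (Subgroup.center H) le_rfl
  obtain ⟨hf, hc⟩ := card_hom_triv_le (K := K) ((Subgroup.center H).subgroupOf N)
  have hbij := hΦ.bijective_of_nat_card_le hc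
  obtain ⟨q, hq⟩ := hbij.2 ⟨pr l N h hD, by
    intro e he
    rw [Subgroup.mem_subgroupOf] at he
    change l ⟨⁅h, (e : H)⁆, _⟩ = 1
    rw [← map_one l]
    congr 1
    apply Subtype.ext
    change ⁅h, (e : H)⁆ = 1
    rw [commutatorElement_eq_one_iff_mul_comm]
    exact Subgroup.mem_center_iff.mp he h⟩
  obtain ⟨n, hn, hnq⟩ := hΦ2 q
  rw [hq] at hnq
  have h1 := pr_inj l hl N h n hD (fun k hk => hNN n hn k hk) hnq
  have : h = n * (n⁻¹ * h) := by group
  rw [this]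
  exact Subgroup.mul_mem_sup hn h1

theorem exists_max_comm [Finite H] (N : Subgroup H) (hZ : Subgroup.center H ≤ N) :
    ∃ B : Subgroup H, Subgroup.center H ≤ B ∧ B ≤ N ∧ (∀ x ∈ B, ∀ y ∈ B, x * y = y * x) ∧
      ∀ g ∈ N, (∀ b ∈ B, g * b = b * g) → g ∈ B := by
  let S : Set (Subgroup H) := {B | Subgroup.center H ≤ B ∧ B ≤ N ∧ ∀ x ∈ B, ∀ y ∈ B, x * y = y * x}
  have hne : S.Nonempty := ⟨Subgroup.center H, le_rfl, hZ, fun x _ y hy =>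
    Subgroup.mem_center_iff.mp hy x⟩
  obtain ⟨B, hB⟩ := (Set.toFinite S).exists_maximal hne
  obtain ⟨h1, h2, h3⟩ := hB.prop
  refine ⟨B, h1, h2, h3, ?_⟩
  intro g hg hgB
  let B' := Subgroup.closure (insert g (B : Set H))
  have hBB' : B ≤ B' := fun b hb => Subgroup.subset_closure (Set.mem_insert_of_mem _ hb)
  have hgB' : g ∈ B' := Subgroup.subset_closure (Set.mem_insert _ _)
  have hk : ∀ x ∈ insert g (B : Set H), ∀ y ∈ insert g (B : Set H), x * y = y * x := by
    rintro x (rfl | hx) y (rfl | hy)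
    · rfl
    · exact hgB y hy
    · exact (hgB x hx).symm
    · exact h3 x hx y hy
  have hB'S : B' ∈ S := by
    refine ⟨h1.trans hBB', ?_, ?_⟩
    · rw [Subgroup.closure_le]
      rintro x (rfl | hx)
      · exact hg
      · exact h2 hx
    · have hle1 : B' ≤ Subgroup.centralizer (insert g (B : Set H)) := by
        rw [Subgroup.closure_le]
        intro x hx
        exact Subgroup.mem_centralizer_iff.mpr fun y hy => hk y hy x hx
      have hle2 : B' ≤ Subgroup.centralizer (B' : Set H) := by
        rw [Subgroup.closure_le]
        intro x hx
        refine Subgroup.mem_centralizer_iff.mpr fun y hy => ?_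
        exact (Subgroup.mem_centralizer_iff.mp (hle1 hy) x hx).symm
      intro x hx y hy
      exact Subgroup.mem_centralizer_iff.mp (hle2 hy) x hx
  exact hB.le_of_ge hB'S hBB' hgB'

end

section
variable {K : Type} [Field K] {H V : Type u} [Group H]
  [AddCommGroup V] [Module K V]

theorem stab_dim [Finite H] [FiniteDimensional K V] (ρ : H →* Module.End K V)
    (l : Subgroup.center H →* K) (hl : Function.Injective l)
    (hlz : ∀ (z : Subgroup.center H) v, ρ z v = l z • v)
    (N : Subgroup H) (hNN : ∀ x ∈ N, ∀ y ∈ N, ⁅x, y⁆ ∈ Subgroup.center H)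
    (B : Subgroup H) (hBN : B ≤ N) (hZB : Subgroup.center H ≤ B)
    (hBB : ∀ x ∈ B, ∀ y ∈ B, x * y = y * x)
    (hmax : ∀ g ∈ N, (∀ b ∈ B, g * b = b * g) → g ∈ B)
    (χ : B → K) (hχ : wt ρ B χ ≠ ⊥) :
    B.relIndex N * Module.finrank K (wt ρ B χ) ≤ Module.finrank K V := by
  have hn := normal_subgroupOf N hNN B hZB
  let B' := B.subgroupOf N
  let ρ' := ρ.comp N.subtype
  let χ' : B' → K := fun b => χ ⟨b, b.2⟩
  have hwt : wt ρ' B' χ' = wt ρ B χ := by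
    ext v
    rw [mem_wt, mem_wt]
    constructor
    · intro h a
      exact h ⟨⟨a, hBN a.2⟩, a.2⟩
    · intro h a
      exact h ⟨a, a.2⟩
  have hdim := orbit_dim ρ' B' (by
    intro x hx y hy
    apply Subtype.ext
    exact hBB x hx y hy) χ'
  let act : MulAction N (B' → K) := wtAct B'
  have hdim : Nat.card (MulAction.orbit N χ') * Module.finrank K (wt ρ' B' χ') ≤
    Module.finrank K V := hdim
  rw [hwt] at hdim
  refine le_trans (Nat.mul_le_mul_right _ ?_) hdim
  have hfin : Finite (MulAction.orbit N χ') := Set.finite_range _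
  rw [← Nat.card_congr (MulAction.orbitEquivQuotientStabilizer N χ').symm]
  change B'.index ≤ (MulAction.stabilizer N χ').index
  refine Nat.le_of_dvd (Nat.pos_of_ne_zero Subgroup.index_ne_zero_of_finite)
    (Subgroup.index_dvd_of_le ?_)
  intro n hnst
  rw [MulAction.mem_stabilizer_iff] at hnst
  rw [Subgroup.mem_subgroupOf]
  apply hmax n n.2
  intro b hb
  obtain ⟨v, hv, hv0⟩ := Submodule.exists_mem_ne_zero_of_ne_bot hχ
  have hv' := mem_wt.mp hv
  let b' : B' := ⟨⟨b, hBN hb⟩, hb⟩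
  have h1 : χ' (MulAut.conjNormal n⁻¹ b') = χ' b' := congrFun hnst b'
  let z : Subgroup.center H := ⟨⁅(n : H)⁻¹, b⁆, hNN _ (inv_mem n.2) b (hBN hb)⟩
  have h2 : ((MulAut.conjNormal n⁻¹ b' : B') : H) = z * b := by
    have : ((MulAut.conjNormal n⁻¹ b' : B') : N) = n⁻¹ * b' * n⁻¹⁻¹ :=
      MulAut.conjNormal_apply _ _
    rw [this]
    change (n : H)⁻¹ * b * ((n : H)⁻¹)⁻¹ = ⁅(n : H)⁻¹, b⁆ * b
    rw [commutatorElement_def]; group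
  have hv3 := hv' ⟨((MulAut.conjNormal n⁻¹ b' : B') : H), (MulAut.conjNormal n⁻¹ b' : B').2⟩
  have hv4 := hv' ⟨b, hb⟩
  change ρ ((MulAut.conjNormal n⁻¹ b' : B') : H) v = χ' (MulAut.conjNormal n⁻¹ b') • v at hv3
  change ρ b v = χ' b' • v at hv4
  rw [h1, h2, rho_mul, hlz, hv4] at hv3
  have hb0 : χ' b' • v ≠ 0 := by
    rw [← hv4]
    intro h
    apply hv0
    rw [← rho_inv_left ρ b v, h, map_zero]
  have hl1 : l z = 1 := by
    have : l z • (χ' b' • v) = (1 : K) • (χ' b' • v) := by rw [one_smul]; exact hv3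
    exact smul_left_injective K hb0 this
  have hz1 : z = 1 := hl (by rw [hl1, map_one])
  have hz2 : ⁅(n : H)⁻¹, b⁆ = 1 := congrArg Subtype.val hz1
  rw [commutatorElement_eq_one_iff_mul_comm] at hz2
  rw [inv_mul_eq_iff_eq_mul] at hz2
  have hz3 : (n : H) * (b * (n : H)⁻¹) * n = b * n := by rw [← hz2]
  rw [← hz3]; group

end

section
variable {K : Type} [Field K] {H V : Type u} [Group H]
  [AddCommGroup V] [Module K V]

theorem lin_case2 [Finite H] [FiniteDimensional K V] [IsAlgClosed K] [Nontrivial V]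
    {p : ℕ} [Fact p.Prime] [CharP K p] {m : ℕ} (hL : ∀ b < m, LIN.{u} b)
    (hs : Group.IsSolvable H) (ho : Odd (Nat.card H)) (ρ : H →* Module.End K V) (hirr : Irr ρ)
    (hinj : Function.Injective ρ) (hm : Module.finrank K V = m)
    (hcs : ∀ A : Subgroup H, A.Normal → (∀ x ∈ A, ∀ y ∈ A, x * y = y * x) →
      A ≤ Subgroup.center H) :
    ∀ x ∈ ds (⊤ : Subgroup H) (gl m), ∃ j : ℕ, ρ x ^ p ^ j = 1 := by
  intro x hx
  have hzz : ∀ k, 1 ≤ k → ds (Subgroup.center H) k = ⊥ := by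
    intro k hk
    rw [eq_bot_iff]
    refine (ds_anti _ hk).trans ?_
    rw [ds_succ, ds_zero, Subgroup.commutator_le]
    intro a _ b hb
    rw [Subgroup.mem_bot, commutatorElement_eq_one_iff_mul_comm]
    exact Subgroup.mem_center_iff.mp hb a
  by_cases hZ : Subgroup.center H = ⊤
  · rw [← hZ, hzz _ (gl_pos m), Subgroup.mem_bot] at hx
    exact ⟨0, by rw [hx, map_one, one_pow]⟩
  obtain ⟨l, hl, hlz⟩ := center_scal ρ hirr hinj
  have hsQ := solvable_quot hs (Subgroup.center H)
  have hoQ := odd_quot ho (Subgroup.center H)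
  have htop : (⊤ : Subgroup (H ⧸ Subgroup.center H)) ≠ ⊥ := by
    intro h
    apply hZ
    rw [eq_top_iff]
    intro g _
    have : (g : H ⧸ Subgroup.center H) ∈ (⊤ : Subgroup (H ⧸ Subgroup.center H)) := trivial
    rw [h, Subgroup.mem_bot] at this
    exact (QuotientGroup.eq_one_iff g).mp this
  obtain ⟨Nb, hNb, -, hNb1, hmin, r, hr, hexp, hcomm, b, hb, hcard⟩ :=
    exists_min_normal hsQ ⊤ htop
  obtain ⟨hi1, hi2⟩ := irr_normal hsQ hoQ hr Nb hexp hcomm hb hcard hmin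
  have hr2 : r ≠ 2 := by
    rintro rfl
    have h1 : 2 ∣ Nat.card (H ⧸ Subgroup.center H) := (dvd_pow_self 2 (by omega)).trans
      (hcard ▸ Nb.card_subgroup_dvd_card)
    have := Odd.of_dvd_nat hoQ h1
    revert this; decide
  have hr3 : 3 ≤ r := by have := hr.two_le; omega
  let N : Subgroup H := Nb.comap (QuotientGroup.mk' (Subgroup.center H))
  have hNn : N.Normal := inferInstance
  have hZN : Subgroup.center H ≤ N := by
    intro z hz
    change (z : H ⧸ Subgroup.center H) ∈ Nb
    rw [(QuotientGroup.eq_one_iff z).mpr hz]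
    exact one_mem _
  have toZ : ∀ a c : H, (a : H ⧸ Subgroup.center H) * c = c * a → ⁅a, c⁆ ∈ Subgroup.center H := by
    intro a c hac
    rw [← QuotientGroup.eq_one_iff]
    have : ((⁅a, c⁆ : H) : H ⧸ Subgroup.center H) = ⁅(a : H ⧸ Subgroup.center H), (c : H ⧸ Subgroup.center H)⁆ := rfl
    rw [this, commutatorElement_eq_one_iff_mul_comm]
    exact hac
  have hNN : ∀ x ∈ N, ∀ y ∈ N, ⁅x, y⁆ ∈ Subgroup.center H := by
    intro a ha c hc
    exact toZ a c (hcomm _ ha _ hc)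
  have hNZ : ¬ N ≤ Subgroup.center H := by
    intro h
    apply hNb1
    rw [eq_bot_iff]
    intro q hq
    obtain ⟨n, rfl⟩ := QuotientGroup.mk_surjective q
    rw [Subgroup.mem_bot, QuotientGroup.eq_one_iff]
    exact h hq
  have hcN : Subgroup.centralizer (N : Set H) ⊓ N ≤ Subgroup.center H := by
    apply hcs _ inferInstance
    intro a ha c hc
    exact Subgroup.mem_centralizer_iff.mp hc.1 a ha.2
  obtain ⟨B, hZB, hBN, hBB, hmax⟩ := exists_max_comm N hZN
  have hBneN : ¬ N ≤ B := by
    intro h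
    apply hNZ
    apply hcs N hNn
    intro a ha c hc
    exact hBB a (h ha) c (h hc)
  have hBneZ : ¬ B ≤ Subgroup.center H := by
    intro h
    apply hBneN
    intro g hg
    apply hmax g hg
    intro c hc
    exact Subgroup.mem_center_iff.mp (h hc) g
  -- indices
  have hidx : (Subgroup.center H).relIndex N = r ^ b := by
    rw [← hcard]
    have h1 : (QuotientGroup.mk' (Subgroup.center H)).ker.relIndex N =
        Nat.card (N.map (QuotientGroup.mk' (Subgroup.center H))) :=
      Subgroup.relIndex_ker _ _
    rw [QuotientGroup.ker_mk', Subgroup.map_comap_eq_self_of_surjective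
      (QuotientGroup.mk'_surjective _)] at h1
    exact h1
  have hprod : (Subgroup.center H).relIndex B * B.relIndex N = r ^ b := by
    rw [Subgroup.relIndex_mul_relIndex _ _ _ hZB hBN, hidx]
  obtain ⟨j, -, hj⟩ := (Nat.dvd_prime_pow hr).mp (Dvd.intro_left _ hprod)
  obtain ⟨i, -, hi⟩ := (Nat.dvd_prime_pow hr).mp (Dvd.intro _ hprod)
  have hij : i + j = b := by
    rw [hi, hj, ← pow_add] at hprod
    exact Nat.pow_right_injective hr.two_le hprod
  have hile : i ≤ j := by
    have := index_le l hl N hNN hcN B hBN hZB hBB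
    rw [hi, hj] at this
    exact (Nat.pow_le_pow_iff_right hr.one_lt).mp this
  have hj1 : 1 ≤ j := by
    rw [Nat.one_le_iff_ne_zero]
    rintro rfl
    rw [pow_zero, Subgroup.relIndex_eq_one] at hj
    exact hBneN hj
  have hi1' : 1 ≤ i := by
    rw [Nat.one_le_iff_ne_zero]
    rintro rfl
    rw [pow_zero, Subgroup.relIndex_eq_one] at hi
    exact hBneZ hi
  obtain ⟨χ, hχ⟩ := exists_wt ρ B hBB
  have hdim := stab_dim ρ l hl hlz N hNN B hBN hZB hBB hmax χ hχ
  rw [hj, hm] at hdim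
  set m' := Module.finrank K (wt ρ B χ) with hm'
  have hm1 : 1 ≤ m' := by
    rw [Nat.one_le_iff_ne_zero, hm', Ne, Submodule.finrank_eq_zero]; exact hχ
  have hrj : 1 + 2 * j ≤ r ^ j := by
    calc 1 + 2 * j = 1 + j * 2 := by ring
      _ ≤ (1 + 2) ^ j := by
        have := one_add_mul_le_pow (a := (2 : ℤ)) (by norm_num) j
        exact_mod_cast this
      _ ≤ r ^ j := Nat.pow_le_pow_left (by omega) j
  have h3m : 3 * m' ≤ m := by nlinarith
  have hmm : m' < m := by omega
  have hbm : b < m := by nlinarith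
  let C := Subgroup.centralizer (N : Set H)
  have hCn : C.Normal := inferInstance
  suffices hk : ∃ k, k + max 2 (gl m') ≤ gl m ∧ ds (⊤ : Subgroup H) k ≤ N ⊔ C by
    obtain ⟨k, hk, hkN⟩ := hk
    have h1 : x ∈ ds (N ⊔ C) (max 2 (gl m')) := by
      refine ds_mono hkN _ ?_
      rw [← ds_add]
      exact ds_anti _ hk hx
    have h2 := ds_sup (A := N) (B := C) (by
      intro a ha c hc
      exact Subgroup.mem_centralizer_iff.mp hc a ha) _ h1
    have h3 : ds N (max 2 (gl m')) = ⊥ := by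
      rw [eq_bot_iff]
      refine (ds_anti N (le_max_left 2 _)).trans ?_
      rw [← hzz 1 le_rfl, ← one_add_one_eq_two, ds_add]
      apply ds_mono
      change ⁅N, N⁆ ≤ _
      rw [Subgroup.commutator_le]
      exact hNN
    rw [h3, bot_sup_eq] at h2
    refine lin_tr (hL m' hmm) hs ho ρ hirr C (wt ρ B χ) ?_ le_rfl hχ x
      (ds_anti _ (le_max_right 2 _) h2)
    intro c hc v hv
    rw [mem_wt] at hv ⊢
    intro a
    rw [← rho_mul, Subgroup.mem_centralizer_iff.mp hc a (hBN a.2), rho_mul, hv a, map_smul]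
  by_cases hsp : r = 3 ∧ b = 2
  · refine ⟨0, ?_, ?_⟩
    · rw [zero_add]; exact arith_case3 hm1 h3m
    · intro g _
      apply mem_sup_centralizer l hl N hNN hcN
      intro n hn
      exact toZ _ _ (hi2 (by tauto) _ _ hn)
  · refine ⟨gl b, arith_case2 hr hr2 (by omega) (by omega) hm1 hdim hsp, ?_⟩
    intro g hg
    apply mem_sup_centralizer l hl N hNN hcN
    intro n hn
    exact toZ _ _ (hi1 (hL b hbm) _ (ds_hom (QuotientGroup.mk' (Subgroup.center H)) hg) _ hn)

theorem lin_faithful [Finite H] [FiniteDimensional K V] [IsAlgClosed K]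
    {p : ℕ} [Fact p.Prime] [CharP K p] {m : ℕ} (hL : ∀ b < m, LIN.{u} b)
    (hs : Group.IsSolvable H) (ho : Odd (Nat.card H)) (ρ : H →* Module.End K V)
    (hinj : Function.Injective ρ) (hm : Module.finrank K V ≤ m) :
    ∀ x ∈ ds (⊤ : Subgroup H) (gl m), ∃ j : ℕ, ρ x ^ p ^ j = 1 := by
  rcases hm.lt_or_eq with hlt | hm
  · intro x hx
    exact hL _ hlt p K H V hs ho ρ le_rfl x (ds_anti _ (gl_mono hlt.le) hx)
  by_cases hirr : Irr ρ
  · rcases subsingleton_or_nontrivial V with hV | hV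
    · intro x _
      exact ⟨0, Subsingleton.elim _ _⟩
    by_cases hA : ∃ A : Subgroup H, A.Normal ∧ (∀ x ∈ A, ∀ y ∈ A, x * y = y * x) ∧
      ¬ A ≤ Subgroup.center H
    · obtain ⟨A, hAn, hAA, hAc⟩ := hA
      exact lin_case1 hL hs ho ρ hirr hinj hm A hAA hAc
    · refine lin_case2 hL hs ho ρ hirr hinj hm ?_
      intro A hAn hAA
      by_contra hAc
      exact hA ⟨A, hAn, hAA, hAc⟩
  · unfold Irr at hirr
    push Not at hirr
    obtain ⟨W, hW, hb, ht⟩ := hirr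
    exact lin_red hL hs ho ρ W hW hm.le hb ht

end

theorem lin_all : ∀ m, LIN.{u} m := by
  intro m
  induction m using Nat.strong_induction_on with
  | _ m ih =>
  intro p _ K _ _ _ H V _ _ _ _ _ hs ho ρ hm x hx
  let ρ' : H ⧸ ρ.ker →* Module.End K V := QuotientGroup.lift ρ.ker ρ (fun a ha => ha)
  have hinj : Function.Injective ρ' := by
    rw [injective_iff_map_eq_one]
    intro q hq
    obtain ⟨g, rfl⟩ := QuotientGroup.mk_surjective q
    rw [QuotientGroup.eq_one_iff]
    exact hq
  have hx' : (QuotientGroup.mk' ρ.ker x) ∈ ds (⊤ : Subgroup (H ⧸ ρ.ker)) (gl m) :=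
    ds_hom (QuotientGroup.mk' ρ.ker) hx
  obtain ⟨j, hj⟩ := lin_faithful (p := p) ih (solvable_quot hs ρ.ker) (odd_quot ho ρ.ker)
    ρ' hinj hm _ hx'
  exact ⟨j, hj⟩

section
variable {G : Type*} [Group G]

theorem comm_mem_iff (N : Subgroup G) [N.Normal] (y n : G) :
    ⁅y, n⁆ ∈ N ↔ Commute (QuotientGroup.mk' N y) (QuotientGroup.mk' N n) := by
  rw [← commutatorElement_eq_one_iff_commute, ← map_commutatorElement]
  exact (QuotientGroup.eq_one_iff _).symm

theorem comm_pow_left {y s n : G} (h : y * n = s * n * y) (hc : Commute y s) (k : ℕ) :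
    y ^ k * n = s ^ k * n * y ^ k := by
  induction k with
  | zero => simp
  | succ k ih =>
    rw [pow_succ', mul_assoc, ih, ← mul_assoc, ← mul_assoc, (hc.pow_right k).eq, mul_assoc (s ^ k), h,
      pow_succ]
    simp [mul_assoc]

theorem comp_lemma (N1 S N : Subgroup G) [N1.Normal] [S.Normal] (x : G) (p a : ℕ)
    (hexp : ∀ s ∈ S, s ^ p ^ a ∈ N1)
    (h1 : ∃ j, ∀ n ∈ N, ⁅x ^ p ^ j, n⁆ ∈ S) (h2 : ∃ j, ∀ s ∈ S, ⁅x ^ p ^ j, s⁆ ∈ N1) :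
    ∃ j, ∀ n ∈ N, ⁅x ^ p ^ j, n⁆ ∈ N1 := by
  obtain ⟨j1, h1⟩ := h1
  obtain ⟨j2, h2⟩ := h2
  refine ⟨j1 + j2 + a, fun n hn => ?_⟩
  have e1 : ⁅x ^ p ^ (j1 + j2), n⁆ ∈ S := by
    have := h1 n hn
    rw [comm_mem_iff] at this ⊢
    rw [pow_add, pow_mul, map_pow]
    exact this.pow_left _
  have e2 : ⁅x ^ p ^ (j1 + j2), ⁅x ^ p ^ (j1 + j2), n⁆⁆ ∈ N1 := by
    have := h2 _ e1
    rw [comm_mem_iff] at this ⊢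
    rw [add_comm j1, pow_add, pow_mul, map_pow]
    rw [add_comm j1, pow_add, pow_mul] at this
    exact this.pow_left _
  have e3 := hexp _ e1
  rw [pow_add, pow_mul]
  generalize x ^ p ^ (j1 + j2) = y at *
  rw [comm_mem_iff] at e2 ⊢
  have e4 : QuotientGroup.mk' N1 y * QuotientGroup.mk' N1 n =
      QuotientGroup.mk' N1 ⁅y, n⁆ * QuotientGroup.mk' N1 n * QuotientGroup.mk' N1 y := by
    rw [← map_mul, ← map_mul, ← map_mul, commutatorElement_def]; congr 1; group
  have e5 := comm_pow_left e4 e2 (p ^ a)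
  rw [← map_pow (QuotientGroup.mk' N1) ⁅y, n⁆] at e5
  have : QuotientGroup.mk' N1 (⁅y, n⁆ ^ p ^ a) = 1 := (QuotientGroup.eq_one_iff _).2 e3
  rw [this, one_mul] at e5
  rw [map_pow]
  exact e5

theorem card_comap_mk [Finite G] (N : Subgroup G) [N.Normal] (S : Subgroup (G ⧸ N)) :
    Nat.card (S.comap (QuotientGroup.mk' N)) = Nat.card S * Nat.card N := by
  have h1 := (S.comap (QuotientGroup.mk' N)).card_mul_index
  rw [Subgroup.index_comap_of_surjective _ (QuotientGroup.mk'_surjective N)] at h1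
  have h2 := S.card_mul_index
  have h3 := N.card_eq_card_quotient_mul_card_subgroup
  have h4 : 0 < S.index := Nat.pos_of_ne_zero Subgroup.FiniteIndex.index_ne_zero
  apply Nat.eq_of_mul_eq_mul_right h4
  rw [h1, h3, ← h2]; ring

theorem le_comap_mk (N : Subgroup G) [N.Normal] (S : Subgroup (G ⧸ N)) :
    N ≤ S.comap (QuotientGroup.mk' N) := by
  intro x hx
  rw [Subgroup.mem_comap]
  have : QuotientGroup.mk' N x = 1 := (QuotientGroup.eq_one_iff _).2 hx
  rw [this]; exact one_mem _

theorem comap_le_of_le_map (N M : Subgroup G) [N.Normal] (hNM : N ≤ M) (S : Subgroup (G ⧸ N))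
    (h : S ≤ M.map (QuotientGroup.mk' N)) : S.comap (QuotientGroup.mk' N) ≤ M := by
  refine (Subgroup.comap_mono h).trans ?_
  rw [Subgroup.comap_map_eq, QuotientGroup.ker_mk']
  exact sup_le le_rfl hNM

theorem lcs_normal (P : Subgroup G) [P.Normal] (i : ℕ) : (P.lowerCentralSeries i).Normal := by
  induction i with
  | zero => assumption
  | succ i ih => rw [Subgroup.lowerCentralSeries_succ]; infer_instance

theorem three_sub (A B C D : Subgroup G) [D.Normal] (h1 : ⁅⁅B, C⁆, A⁆ ≤ D) (h2 : ⁅⁅C, A⁆, B⁆ ≤ D) :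
    ⁅⁅A, B⁆, C⁆ ≤ D := by
  have key : ∀ X : Subgroup G, X.map (QuotientGroup.mk' D) = ⊥ ↔ X ≤ D := by
    intro X; rw [Subgroup.map_eq_bot_iff, QuotientGroup.ker_mk']
  rw [← key] at h1 h2 ⊢
  rw [Subgroup.map_commutator, Subgroup.map_commutator] at h1 h2 ⊢
  exact Subgroup.commutator_commutator_eq_bot_of_rotate h1 h2

theorem lcs_comm (P : Subgroup G) [P.Normal] (j : ℕ) : ∀ i,
    ⁅P.lowerCentralSeries i, P.lowerCentralSeries j⁆ ≤ P.lowerCentralSeries (i + j + 1) := by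
  induction j with
  | zero => intro i; exact le_rfl
  | succ j ih =>
    intro i
    have := lcs_normal P (i + (j + 1) + 1)
    rw [Subgroup.lowerCentralSeries_succ P j, Subgroup.commutator_comm]
    apply three_sub
    · rw [Subgroup.commutator_comm P, ← Subgroup.lowerCentralSeries_succ]
      refine (ih (i + 1)).trans (le_of_eq ?_)
      congr 1; ring
    · refine (Subgroup.commutator_mono (ih i) le_rfl).trans (le_of_eq ?_)
      rw [← Subgroup.lowerCentralSeries_succ]
      congr 1

theorem ds_le_lcs (P : Subgroup G) [P.Normal] (i : ℕ) :
    ds P i ≤ P.lowerCentralSeries (2 ^ i - 1) := by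
  induction i with
  | zero => exact le_rfl
  | succ i ih =>
    rw [ds_succ]
    refine (Subgroup.commutator_mono ih ih).trans ((lcs_comm P _ _).trans (le_of_eq ?_))
    congr 1
    have := Nat.one_le_two_pow (n := i)
    rw [pow_succ]; omega

end

theorem el_two {G : Type u} [Group G] [Finite G] (hs : Group.IsSolvable G) (ho : Odd (Nat.card G))
    {p m : ℕ} (hp : p.Prime) (N1 : Subgroup G) [N1.Normal] (x : G)
    (hx : x ∈ ds (⊤ : Subgroup G) (gl m)) (N : Subgroup G) [N.Normal] :
    ∀ (t : ℕ), t ≤ m → N1 ≤ N → Nat.card N = p ^ t * Nat.card N1 →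
    ∃ j, ∀ n ∈ N, ⁅x ^ p ^ j, n⁆ ∈ N1 := by
  intro t
  induction t using Nat.strong_induction_on generalizing N1 with
  | _ t ih =>
  intro htm hle hcard
  rcases Nat.eq_zero_or_pos t with rfl | ht
  · have : N1 = N := Subgroup.eq_of_le_of_card_ge hle (by rw [hcard]; simp)
    subst this
    exact ⟨0, fun n hn => Subgroup.commutator_le_right ⊤ N1
      (Subgroup.commutator_mem_commutator trivial hn)⟩
  have hc1 : 0 < Nat.card N1 := Nat.card_pos
  have hmn : (N.map (QuotientGroup.mk' N1)).Normal :=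
    Subgroup.Normal.map inferInstance _ (QuotientGroup.mk'_surjective N1)
  have hne : N.map (QuotientGroup.mk' N1) ≠ ⊥ := by
    intro h
    rw [Subgroup.map_eq_bot_iff, QuotientGroup.ker_mk'] at h
    have e : N1 = N := le_antisymm hle h
    rw [← e] at hcard
    have : 1 < p ^ t := Nat.one_lt_pow (by omega) hp.one_lt
    nlinarith
  obtain ⟨S, hSn, hSle, hSne, -, r, hr, hexp, hcomm, b, hb, hSc⟩ :=
    exists_min_normal (solvable_quot hs N1) _ hne
  have hcS := card_comap_mk N1 S
  have hSN := comap_le_of_le_map N1 N hle S hSle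
  have hdvd := Subgroup.card_dvd_of_le hSN
  rw [hcS, hcard, hSc] at hdvd
  have hd2 : r ^ b ∣ p ^ t := Nat.dvd_of_mul_dvd_mul_right hc1 hdvd
  have hrp : r = p := (Nat.prime_dvd_prime_iff_eq hr hp).1
    (hr.dvd_of_dvd_pow ((dvd_pow_self r (by omega)).trans hd2))
  subst hrp
  have hbt : b ≤ t := (Nat.pow_dvd_pow_iff_le_right hr.one_lt).1 hd2
  have hel := el_normal (solvable_quot hs N1) (odd_quot ho N1) hr S hexp hcomm hSc (lin_all b)
    (QuotientGroup.mk' N1 x) (ds_anti _ (gl_mono (hbt.trans htm)) (ds_hom (QuotientGroup.mk' N1) hx))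
  obtain ⟨j, hj⟩ := hel
  have hSN' : (S.comap (QuotientGroup.mk' N1)).Normal := inferInstance
  have h1 := ih (t - b) (by omega) (S.comap (QuotientGroup.mk' N1)) (by omega) hSN (by
    rw [hcS, hSc, hcard, ← mul_assoc, ← pow_add]; congr 2; omega)
  refine comp_lemma N1 (S.comap (QuotientGroup.mk' N1)) N x r 1 ?_ h1 ⟨j, ?_⟩
  · intro s hs
    rw [pow_one, ← QuotientGroup.eq_one_iff]
    exact hexp _ hs
  · intro s hs
    rw [comm_mem_iff, map_pow]
    exact hj _ hs

theorem Omega_mul {a b : ℕ} (ha : a ≠ 0) (hb : b ≠ 0) : Omega (a * b) = Omega a + Omega b := by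
  have := ArithmeticFunction.cardFactors_mul ha hb
  simpa [Omega, ArithmeticFunction.cardFactors_apply] using this

theorem Omega_pow {p l : ℕ} (hp : p.Prime) : Omega (p ^ l) = l := by
  have := ArithmeticFunction.cardFactors_apply_prime_pow (k := l) hp
  simpa [Omega, ArithmeticFunction.cardFactors_apply] using this

theorem Omega_pos {n : ℕ} (h : 1 < n) : 1 ≤ Omega n := by
  rw [Omega, Nat.one_le_iff_ne_zero, Ne, List.length_eq_zero_iff, Nat.primeFactorsList_eq_nil]
  omega

theorem Omega_quot {G : Type*} [Group G] [Finite G] (P : Subgroup G) :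
    Omega (Nat.card G) = Omega (Nat.card (G ⧸ P)) + Omega (Nat.card P) := by
  rw [P.card_eq_card_quotient_mul_card_subgroup, Omega_mul Nat.card_pos.ne' Nat.card_pos.ne']

theorem main_fit {G : Type u} [Group G] [Finite G] (hs : Group.IsSolvable G)
    (ho : Odd (Nat.card G)) {p : ℕ} (hp : p.Prime) (P : Subgroup G) [P.Normal] (hP : IsPGroup p P)
    (hne : P ≠ ⊥) (hmax : ∀ M : Subgroup G, M.Normal → IsPGroup p M → M ≤ P)
    (hcent : ∀ x, (∀ n ∈ P, x * n = n * x) → x ∈ P) (d : ℕ) (hd : ds (⊤ : Subgroup G) d ≠ ⊥) :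
    7 ^ (d + 1) < 49 * (Omega (Nat.card G)) ^ 5 := by
  classical
  have := Fact.mk hp
  have hnil : ∃ c, P.lowerCentralSeries c = ⊥ :=
    (Subgroup.isNilpotent_iff_lowerCentralSeries P).1 hP.isNilpotent
  have hnor := lcs_normal P
  have hanti := P.lowerCentralSeries_antitone
  have hgp : ∀ i, ∃ a, Nat.card (P.lowerCentralSeries i) = p ^ a := by
    intro i
    exact (IsPGroup.iff_card).1 (hP.to_le (hanti (Nat.zero_le i)))
  choose a ha using hgp
  obtain ⟨c, hc, hcmin⟩ : ∃ c, P.lowerCentralSeries c = ⊥ ∧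
      ∀ i < c, P.lowerCentralSeries i ≠ ⊥ :=
    ⟨Nat.find hnil, Nat.find_spec hnil, fun i hi => Nat.find_min hnil hi⟩
  have hstrict : ∀ i < c, a (i + 1) < a i := by
    intro i hi
    have hlt : P.lowerCentralSeries (i + 1) ≠ P.lowerCentralSeries i := by
      intro he
      have : ∀ n, P.lowerCentralSeries (i + n) = P.lowerCentralSeries i := by
        intro n
        induction n with
        | zero => rfl
        | succ n ih =>
          rw [← add_assoc, Subgroup.lowerCentralSeries_succ, ih,
            ← Subgroup.lowerCentralSeries_succ, he]
      have h2 := this (c - i)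
      rw [Nat.add_sub_cancel' hi.le, hc] at h2
      exact hcmin i hi h2.symm
    by_contra hcon
    push Not at hcon
    apply hlt
    apply Subgroup.eq_of_le_of_card_ge (hanti (Nat.le_succ i))
    rw [ha, ha]
    exact Nat.pow_le_pow_right hp.pos hcon
  have hl : Nat.card P = p ^ a 0 := ha 0
  set l := a 0 with hldef
  have hup : ∀ i ≤ c, a i + i ≤ l := by
    intro i
    induction i with
    | zero => intro _; omega
    | succ i ih =>
      intro hi
      have := ih (by omega)
      have := hstrict i (by omega)
      omega
  have hlow : ∀ n ≤ c, n ≤ a (c - n) := by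
    intro n
    induction n with
    | zero => intro _; omega
    | succ n ih =>
      intro hi
      have h1 := ih (by omega)
      have h2 := hstrict (c - (n + 1)) (by omega)
      rw [show c - (n + 1) + 1 = c - n by omega] at h2
      omega
  have hkex : ∃ k, ds P k = ⊥ := by
    refine ⟨c, ?_⟩
    rw [eq_bot_iff, ← hc]
    refine (ds_le_lcs P c).trans (hanti ?_)
    have := Nat.lt_two_pow_self (n := c)
    omega
  obtain ⟨k, hk, hkmin⟩ : ∃ k, ds P k = ⊥ ∧ ∀ i < k, ds P i ≠ ⊥ :=
    ⟨Nat.find hkex, Nat.find_spec hkex, fun i hi => Nat.find_min hkex hi⟩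
  have hk1 : 1 ≤ k := by
    rcases Nat.eq_zero_or_pos k with rfl | h
    · exact absurd hk hne
    · exact h
  have hkc : 2 ^ (k - 1) ≤ c := by
    by_contra hcon
    push Not at hcon
    apply hkmin (k - 1) (by omega)
    rw [eq_bot_iff, ← hc]
    exact (ds_le_lcs P _).trans (hanti (by omega))
  have hcl : c ≤ l := by
    have := hlow c le_rfl
    simpa using this
  have hOm : Omega (Nat.card G) = Omega (Nat.card (G ⧸ P)) + l := by
    rw [Omega_quot P, hl, Omega_pow hp]
  by_cases hPt : P = ⊤
  · refine arith_final2 hk1 ?_ (show 2 ^ (k - 1) ≤ Omega (Nat.card G) by omega)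
    by_contra hcon
    apply hd
    rw [eq_bot_iff, ← hk, hPt]
    exact ds_anti _ (by omega)
  obtain ⟨m, hm⟩ : ∃ m, m + 2 ^ (k - 1) = l + 1 := ⟨l + 1 - 2 ^ (k - 1), by omega⟩
  have hexpP : ∀ s ∈ P, s ^ p ^ l = 1 := by
    intro s hs
    have := pow_card_eq_one' (x := (⟨s, hs⟩ : P))
    rw [hl] at this
    simpa using congrArg Subtype.val this
  have hOm1 : 1 ≤ Omega (Nat.card (G ⧸ P)) := by
    apply Omega_pos
    have h1 : 0 < Nat.card (G ⧸ P) := Nat.card_pos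
    have h2 : Nat.card (G ⧸ P) ≠ 1 := by
      intro h
      exact hPt (Subgroup.index_eq_one.1 h)
    omega
  refine arith_final (m := m) hk1 (by omega) ?_ (show m + 2 ^ (k - 1) ≤ Omega (Nat.card G) by omega)
  have hcen : ∀ x ∈ ds (⊤ : Subgroup G) (gl m), ∃ j, ∀ n ∈ P, ⁅x ^ p ^ j, n⁆ ∈ (⊥ : Subgroup G) := by
    intro x hx
    have key : ∀ i ≤ c, ∃ j, ∀ n ∈ P, ⁅x ^ p ^ j, n⁆ ∈ P.lowerCentralSeries i := by
      intro i
      induction i with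
      | zero =>
        intro _
        exact ⟨0, fun n hn => Subgroup.commutator_le_right ⊤ P
          (Subgroup.commutator_mem_commutator trivial hn)⟩
      | succ i ih =>
        intro hi
        refine comp_lemma _ (P.lowerCentralSeries i) P x p l ?_ (ih (by omega)) ?_
        · intro s hs
          rw [hexpP s (hanti (Nat.zero_le i) hs)]
          exact one_mem _
        · have h1 := hup i (by omega)
          have h2 := hlow (c - (i + 1)) (by omega)
          rw [show c - (c - (i + 1)) = i + 1 by omega] at h2
          have h3 := hstrict i (by omega)
          refine el_two hs ho hp _ x hx _ (a i - a (i + 1)) (by omega) (hanti (Nat.le_succ i)) ?_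
          rw [ha, ha, ← pow_add]
          congr 1; omega
    have := key c le_rfl
    rwa [hc] at this
  have hle : ds (⊤ : Subgroup G) (gl m) ≤ P := by
    apply hmax _ (ds_normal _ _)
    rintro ⟨x, hx⟩
    obtain ⟨j, hj⟩ := hcen x hx
    have hxP : x ^ p ^ j ∈ P := by
      apply hcent
      intro n hn
      have := hj n hn
      rw [Subgroup.mem_bot, commutatorElement_eq_one_iff_mul_comm] at this
      exact this
    refine ⟨j + l, ?_⟩
    ext
    have := hexpP _ hxP
    rw [← pow_mul, ← pow_add] at this
    simpa using this
  by_contra hcon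
  apply hd
  rw [eq_bot_iff, ← hk]
  refine (ds_anti _ (show gl m + k ≤ d by omega)).trans ?_
  rw [ds_add]
  exact ds_mono hle k

theorem eq_one_of_coprime_pow {G : Type*} [Group G] {z : G} {a b : ℕ} (h : Nat.Coprime a b)
    (ha : z ^ a = 1) (hb : z ^ b = 1) : z = 1 := by
  rw [← orderOf_eq_one_iff]
  have := Nat.dvd_gcd (orderOf_dvd_of_pow_eq_one ha) (orderOf_dvd_of_pow_eq_one hb)
  rw [h] at this
  exact Nat.dvd_one.1 this

theorem cent_le {G : Type*} [Group G] [Finite G] (hs : Group.IsSolvable G)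
    {p : ℕ} (hp : p.Prime) (P N : Subgroup G) [P.Normal] (hP : IsPGroup p P)
    (hN : ∀ x ∈ N, x ^ p = 1)
    (hmax : ∀ M : Subgroup G, M.Normal → IsPGroup p M → M ≤ P)
    (hinter : ∀ M : Subgroup G, M.Normal → M ⊓ N = ⊥ → M = ⊥) :
    ∀ x, (∀ n ∈ P, x * n = n * x) → x ∈ P := by
  have := Fact.mk hp
  have hCmem : ∀ x, x ∈ Subgroup.centralizer (P : Set G) ↔ ∀ n ∈ P, n * x = x * n := by
    intro x; rw [Subgroup.mem_centralizer_iff]; rfl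
  suffices h : Subgroup.centralizer (P : Set G) ≤ P by
    intro x hx
    exact h ((hCmem x).2 fun n hn => (hx n hn).symm)
  by_contra hcon
  have hCn : (Subgroup.centralizer (P : Set G)).Normal := inferInstance
  set C := Subgroup.centralizer (P : Set G) with hCdef
  have hZn : (C ⊓ P).Normal := inferInstance
  set Z := C ⊓ P with hZdef
  have hmn : (C.map (QuotientGroup.mk' Z)).Normal :=
    Subgroup.Normal.map inferInstance _ (QuotientGroup.mk'_surjective Z)
  have hne : C.map (QuotientGroup.mk' Z) ≠ ⊥ := by
    intro h
    rw [Subgroup.map_eq_bot_iff, QuotientGroup.ker_mk'] at h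
    exact hcon (h.trans inf_le_right)
  obtain ⟨S, hSn, hSle, hSne, -, q, hq, hexp, hcomm, b, hb, hSc⟩ :=
    exists_min_normal (solvable_quot hs Z) _ hne
  have hcM := card_comap_mk Z S
  have hMC := comap_le_of_le_map Z C inf_le_left S hSle
  have hMn : (S.comap (QuotientGroup.mk' Z)).Normal := inferInstance
  have hSM : ∀ x ∈ S.comap (QuotientGroup.mk' Z), QuotientGroup.mk' Z x ∈ S := fun x hx => hx
  set M := S.comap (QuotientGroup.mk' Z) with hM
  have hZp : IsPGroup p Z := hP.to_le inf_le_right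
  obtain ⟨e, he⟩ := IsPGroup.iff_card.1 hZp
  rw [hSc] at hcM
  by_cases hqp : q = p
  · subst hqp
    have hMp : IsPGroup q M := IsPGroup.of_card (n := b + e) (by rw [hcM, he, pow_add])
    have hMZ : M ≤ Z := le_inf hMC (hmax M hMn hMp)
    have h1 := Nat.le_of_dvd Nat.card_pos (Subgroup.card_dvd_of_le hMZ)
    have h2 : 1 < q ^ b := Nat.one_lt_pow (by omega) hq.one_lt
    have h3 : 0 < Nat.card Z := Nat.card_pos
    rw [hcM] at h1
    nlinarith
  have hcop : Nat.Coprime q p := (Nat.coprime_primes hq hp).2 hqp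
  have hab : ∀ x ∈ M, ∀ y ∈ M, x * y = y * x := by
    intro x hx y hy
    have hz : ⁅x, y⁆ ∈ Z := by
      rw [comm_mem_iff]
      exact hcomm _ (hSM x hx) _ (hSM y hy)
    have hxq : x ^ q ∈ Z := by
      rw [← QuotientGroup.eq_one_iff]
      exact hexp _ (hSM x hx)
    have e1 : x * y = ⁅x, y⁆ * y * x := by rw [commutatorElement_def]; group
    have e2 : Commute x ⁅x, y⁆ := ((hCmem x).1 (hMC hx) _ hz.2).symm
    have e3 := comm_pow_left e1 e2 q
    have e4 := (hCmem y).1 (hMC hy) _ hxq.2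
    rw [e4, mul_assoc] at e3
    have e5 : ⁅x, y⁆ ^ q = 1 := by
      have := right_eq_mul.1 e3
      exact this
    obtain ⟨k, hk⟩ := hP ⟨⁅x, y⁆, hz.2⟩
    have e6 : ⁅x, y⁆ ^ p ^ k = 1 := by simpa using congrArg Subtype.val hk
    have e7 := eq_one_of_coprime_pow (hcop.pow_right k) e5 e6
    exact commutatorElement_eq_one_iff_mul_comm.1 e7
  let T : Subgroup G :=
    { carrier := {x | x ∈ M ∧ x ^ q = 1}
      mul_mem' := by
        rintro x y ⟨hx, hx1⟩ ⟨hy, hy1⟩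
        refine ⟨mul_mem hx hy, ?_⟩
        rw [(show Commute x y from hab x hx y hy).mul_pow, hx1, hy1, one_mul]
      one_mem' := ⟨one_mem _, one_pow _⟩
      inv_mem' := by
        rintro x ⟨hx, hx1⟩
        exact ⟨inv_mem hx, by rw [inv_pow, hx1, inv_one]⟩ }
  have hTn : T.Normal := by
    refine ⟨?_⟩
    rintro x ⟨hx, hx1⟩ g
    refine ⟨hMn.conj_mem x hx g, ?_⟩
    rw [conj_pow, hx1, mul_one, mul_inv_cancel]
  have hTb : T = ⊥ := by
    apply hinter T hTn
    rw [eq_bot_iff]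
    rintro x ⟨⟨-, hx1⟩, hx2⟩
    exact eq_one_of_coprime_pow hcop hx1 (hN x hx2)
  have := Fact.mk hq
  have hdv : q ∣ Nat.card M := by
    rw [hcM]; exact Dvd.dvd.mul_right (dvd_pow_self q (by omega)) _
  obtain ⟨g, hg⟩ := exists_prime_orderOf_dvd_card' q hdv
  have hgT : (g : G) ∈ T := by
    refine ⟨g.2, ?_⟩
    have := pow_orderOf_eq_one g
    rw [hg] at this
    simpa using congrArg Subtype.val this
  rw [hTb, Subgroup.mem_bot] at hgT
  have : g = 1 := Subtype.ext hgT
  rw [this, orderOf_one] at hg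
  exact hq.one_lt.ne hg

theorem main_all : ∀ n : ℕ, ∀ (G : Type u) [Group G] [Finite G], Nat.card G = n →
    Group.IsSolvable G → Odd (Nat.card G) → ∀ d, ds (⊤ : Subgroup G) d ≠ ⊥ →
    7 ^ (d + 1) < 49 * (Omega (Nat.card G)) ^ 5 := by
  intro n
  induction n using Nat.strong_induction_on with
  | _ n ih =>
  intro G _ _ hcard hs ho d hd
  have hquot : ∀ M : Subgroup G, M.Normal → M ≠ ⊥ → ¬ ds (⊤ : Subgroup G) d ≤ M →
      7 ^ (d + 1) < 49 * (Omega (Nat.card G)) ^ 5 := by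
    intro M hM hMne hdM
    have h1 := M.card_eq_card_quotient_mul_card_subgroup
    have h2 : 1 < Nat.card M := (Subgroup.one_lt_card_iff_ne_bot M).2 hMne
    have h3 : 0 < Nat.card (G ⧸ M) := Nat.card_pos
    have h4 := ih (Nat.card (G ⧸ M)) (by nlinarith) (G ⧸ M) rfl (solvable_quot hs M)
      (odd_quot ho M) d (by
        intro h
        apply hdM
        have h5 := ds_map (QuotientGroup.mk' M) ⊤ d
        rw [Subgroup.map_top_of_surjective _ (QuotientGroup.mk'_surjective M), h,
          Subgroup.map_eq_bot_iff, QuotientGroup.ker_mk'] at h5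
        exact h5)
    refine h4.trans_le (Nat.mul_le_mul_left _ (Nat.pow_le_pow_left ?_ 5))
    rw [Omega_quot M]; omega
  have htop : (⊤ : Subgroup G) ≠ ⊥ := by
    intro h
    apply hd
    rw [eq_bot_iff, ← h]
    exact ds_le _ _
  obtain ⟨N, hNn, -, hNne, -, p, hp, hexp, -, b, hb, hNc⟩ := exists_min_normal hs ⊤ htop
  by_cases hM : ∃ M : Subgroup G, M.Normal ∧ M ⊓ N = ⊥ ∧ M ≠ ⊥
  · obtain ⟨M, hMn, hMN, hMne⟩ := hM
    by_cases h1 : ds (⊤ : Subgroup G) d ≤ M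
    · refine hquot N hNn hNne fun h2 => hd ?_
      rw [eq_bot_iff, ← hMN]
      exact le_inf h1 h2
    · exact hquot M hMn hMne h1
  push Not at hM
  have := Fact.mk hp
  obtain ⟨P, hPmax⟩ := (Set.toFinite {M : Subgroup G | M.Normal ∧ IsPGroup p M}).exists_maximal
    ⟨⊥, inferInstance, IsPGroup.of_bot⟩
  obtain ⟨hPn, hP⟩ := hPmax.prop
  have hmax : ∀ M : Subgroup G, M.Normal → IsPGroup p M → M ≤ P := by
    intro M hMn hMp
    refine le_sup_left.trans (hPmax.le_of_ge (y := M ⊔ P) ⟨inferInstance, ?_⟩ le_sup_right)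
    exact IsPGroup.to_sup_of_normal_right hMp hP
  have hNP : N ≤ P := hmax N hNn (IsPGroup.of_card hNc)
  refine main_fit hs ho hp P hP ?_ hmax (cent_le hs hp P N hP hexp hmax hM) d hd
  rintro rfl
  exact hNne (le_bot_iff.1 hNP)

/-- Every nontrivial finite solvable group `G` of odd order with derived length `d`
satisfies `7^((d−2)/5) < Ω(|G|)`. -/
theorem seven_rpow_lt_comp_length_of_odd (G : Type*) [Group G] [Finite G] [Nontrivial G]
    (hG : IsSolvable G) (hodd : Odd (Nat.card G)) (d : ℕ) (hd : DerivedLengthEq G d) :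
    (7 : ℝ) ^ (((d : ℝ) - 2) / 5) < (Omega (Nat.card G) : ℝ) := by
  obtain ⟨hd0, hd1⟩ := hd
  have hdpos : d ≠ 0 := by
    rintro rfl
    rw [derivedSeries_zero] at hd0
    exact top_ne_bot hd0
  have hmain := main_all (Nat.card G) G rfl hG hodd (d - 1) (by
    rw [ds_top]; exact hd1 _ (by omega))
  rw [Nat.sub_add_cancel (by omega)] at hmain
  have h1 : (7 : ℝ) ^ d < 49 * (Omega (Nat.card G) : ℝ) ^ 5 := by exact_mod_cast hmain
  refine lt_of_pow_lt_pow_left₀ 5 (by positivity) ?_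
  rw [← Real.rpow_natCast, ← Real.rpow_mul (by norm_num)]
  have h2 : ((d : ℝ) - 2) / 5 * ((5 : ℕ) : ℝ) = (d : ℝ) - 2 := by push_cast; ring
  rw [h2, Real.rpow_sub (by norm_num), Real.rpow_natCast]
  rw [div_lt_iff₀ (by positivity)]
  have h3 : (7 : ℝ) ^ (2 : ℝ) = 49 := by
    rw [show (2 : ℝ) = ((2 : ℕ) : ℝ) by norm_num, Real.rpow_natCast]; norm_num
  rw [h3]; linarith
end

section
/- For every integer d ≥ 1 there exists a finite solvable group G of odd order with derived length exactly d such that Ω(|G|) < 2^d, where Ω(|G|) is the number of prime factors of |G| counted with multiplicity. -/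
open Matrix
open scoped commutatorElement

namespace OddSolv

section gen
variable {R : Type} [CommRing R] (t : R)

def PE (i : ℕ) (M : Matrix (Fin 2) (Fin 2) R) : Prop :=
  ∃ x u z w, IsUnit u ∧ M = !![t^(i+1)*x, t^i*u; t^(i+2)*z, t^(i+1)*w]
def PF (i : ℕ) (M : Matrix (Fin 2) (Fin 2) R) : Prop :=
  ∃ x y u w, IsUnit u ∧ M = !![t^i*x, t^i*y; t^i*u, t^i*w]
def PH (i : ℕ) (M : Matrix (Fin 2) (Fin 2) R) : Prop :=
  ∃ u y z w, IsUnit u ∧ M = !![t^i*u, t^i*y; t^(i+1)*z, t^i*(-u+t*w)]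
def PK (M : Matrix (Fin 2) (Fin 2) R) : Prop :=
  ∃ a b c d, M = !![1+t*a, b; t*c, 1+t*d]

variable {t}

lemma PE.mul (ht : ∀ u a : R, IsUnit u → IsUnit (u + t * a))
    {i : ℕ} {M K : Matrix (Fin 2) (Fin 2) R} (hM : PE t i M) (hK : PK t K) :
    PE t i (M * K) := by
  obtain ⟨x, u, z, w, hu, rfl⟩ := hM
  obtain ⟨a, b, c, d, rfl⟩ := hK
  refine ⟨x*(1+t*a)+u*c, u + t*(u*d+x*b), z*(1+t*a)+w*c, t*z*b+w*(1+t*d), ht _ _ hu, ?_⟩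
  rw [Matrix.mul_fin_two]
  congr! 3 <;> ring_nf

lemma PF.mul (ht : ∀ u a : R, IsUnit u → IsUnit (u + t * a))
    {i : ℕ} {M K : Matrix (Fin 2) (Fin 2) R} (hM : PF t i M) (hK : PK t K) :
    PF t i (M * K) := by
  obtain ⟨x, y, u, w, hu, rfl⟩ := hM
  obtain ⟨a, b, c, d, rfl⟩ := hK
  refine ⟨x*(1+t*a)+y*(t*c), x*b+y*(1+t*d), u+t*(u*a+w*c), u*b+w*(1+t*d), ht _ _ hu, ?_⟩
  rw [Matrix.mul_fin_two]
  congr! 3 <;> ring_nf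

lemma PH.mul (ht : ∀ u a : R, IsUnit u → IsUnit (u + t * a))
    {i : ℕ} {M K : Matrix (Fin 2) (Fin 2) R} (hM : PH t i M) (hK : PK t K) :
    PH t i (M * K) := by
  obtain ⟨u, y, z, w, hu, rfl⟩ := hM
  obtain ⟨a, b, c, d, rfl⟩ := hK
  refine ⟨u+t*(u*a+y*c), u*b+y*(1+t*d), z*(1+t*a)+(-u+t*w)*c,
    u*a+y*c+z*b-u*d+w+t*w*d, ht _ _ hu, ?_⟩
  rw [Matrix.mul_fin_two]
  congr! 3 <;> ring_nf

lemma br_EF (ht : ∀ u a : R, IsUnit u → IsUnit (u + t * a))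
    {i j : ℕ} {X Y : Matrix (Fin 2) (Fin 2) R} (hX : PE t i X) (hY : PF t j Y) :
    PH t (i+j) (X * Y - Y * X) := by
  obtain ⟨x, u, z, w, hu, rfl⟩ := hX
  obtain ⟨x', y', u', w', hu', rfl⟩ := hY
  refine ⟨u*u'+t*(-t*y'*z), t*x*y'+u*w'-x'*u-t*y'*w, t*z*x'+w*u'-u'*x-w'*t*z, 0,
    ht _ _ (hu.mul hu'), ?_⟩
  rw [Matrix.mul_fin_two, Matrix.mul_fin_two]
  ext a b; fin_cases a <;> fin_cases b <;> simp <;> ring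

lemma br_HE (ht : ∀ u a : R, IsUnit u → IsUnit (u + t * a)) (h2 : IsUnit (2:R))
    {i j : ℕ} {X Y : Matrix (Fin 2) (Fin 2) R} (hX : PH t i X) (hY : PE t j Y) :
    PE t (i+j) (X * Y - Y * X) := by
  obtain ⟨u, y, z, w, hu, rfl⟩ := hX
  obtain ⟨x', u', z', w', hu', rfl⟩ := hY
  refine ⟨t*y*z'-u'*z, 2*u*u'+t*(y*w'-x'*y-u'*w), z*x'+(-u+t*w)*z'-z'*u-w'*z, z*u'-t*z'*y,
    ht _ _ ((h2.mul hu).mul hu'), ?_⟩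
  rw [Matrix.mul_fin_two, Matrix.mul_fin_two]
  ext a b; fin_cases a <;> fin_cases b <;> simp <;> ring

lemma br_HF (ht : ∀ u a : R, IsUnit u → IsUnit (u + t * a)) (h2 : IsUnit (2:R))
    {i j : ℕ} {X Y : Matrix (Fin 2) (Fin 2) R} (hX : PH t i X) (hY : PF t j Y) :
    PF t (i+j) (X * Y - Y * X) := by
  obtain ⟨u, y, z, w, hu, rfl⟩ := hX
  obtain ⟨x', y', u', w', hu', rfl⟩ := hY
  refine ⟨y*u'-y'*t*z, u*y'+y*w'-x'*y-y'*(-u+t*w), -(2*u*u')+t*(z*x'+w*u'-w'*z), t*z*y'-u'*y,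
    ht _ _ ((h2.mul hu).mul hu').neg, ?_⟩
  rw [Matrix.mul_fin_two, Matrix.mul_fin_two]
  ext a b; fin_cases a <;> fin_cases b <;> simp <;> ring

variable (t) in
/-- pro-`p` Iwahori subgroup -/
def Iw : Subgroup (SpecialLinearGroup (Fin 2) R) where
  carrier := {g | PK t (g : Matrix (Fin 2) (Fin 2) R)}
  one_mem' := ⟨0, 0, 0, 0, by
    ext a b; fin_cases a <;> fin_cases b <;> simp⟩
  mul_mem' := by
    rintro g h ⟨a, b, c, d, hg⟩ ⟨a', b', c', d', hh⟩
    refine ⟨a+a'+t*a*a'+b*c', (1+t*a)*b'+b*(1+t*d'), c*(1+t*a')+(1+t*d)*c', c*b'+d+d'+t*d*d', ?_⟩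
    show g.1 * h.1 = _
    rw [show g.1 = _ from hg, show h.1 = _ from hh, Matrix.mul_fin_two]
    congr! 3 <;> ring_nf
  inv_mem' := by
    rintro g ⟨a, b, c, d, hg⟩
    refine ⟨d, -b, -c, a, ?_⟩
    show g.1.adjugate = _
    rw [show g.1 = _ from hg, Matrix.adjugate_fin_two_of]
    congr! 3; ring_nf

/-- the matrix `g - 1` -/
def mm (g : Iw t) : Matrix (Fin 2) (Fin 2) R := ((g : SpecialLinearGroup (Fin 2) R) : Matrix _ _ R) - 1

/-- the underlying matrix -/
def mt (g : Iw t) : Matrix (Fin 2) (Fin 2) R := ((g : SpecialLinearGroup (Fin 2) R) : Matrix _ _ R)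

lemma mt_mul (g h : Iw t) : mt (g * h) = mt g * mt h := rfl

lemma mt_one : mt (1 : Iw t) = 1 := rfl

lemma mm_eq (g : Iw t) : mm g = mt g - 1 := rfl

lemma mm_comm (g h : Iw t) : ∃ K, PK t K ∧ mm ⁅g, h⁆ = (mm g * mm h - mm h * mm g) * K := by
  refine ⟨mt (g⁻¹ * h⁻¹), (g⁻¹ * h⁻¹).2, ?_⟩
  have h1 : mm g * mm h - mm h * mm g = mt (g * h) - mt (h * g) := by
    rw [mt_mul, mt_mul, mm_eq, mm_eq]
    noncomm_ring
  have e1 : g * h * (g⁻¹ * h⁻¹) = ⁅g, h⁆ := by rw [commutatorElement_def]; group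
  have e2 : h * g * (g⁻¹ * h⁻¹) = 1 := by group
  rw [h1, sub_mul, ← mt_mul, ← mt_mul, e1, e2, mt_one, mm_eq]

def SO (t : R) (n i : ℕ) : Prop := (∃ g ∈ derivedSeries (Iw t) n, PE t i (mm g)) ∧
  (∃ g ∈ derivedSeries (Iw t) n, PF t (i+1) (mm g)) ∧ ∃ g ∈ derivedSeries (Iw t) n, PH t (i+1) (mm g)
def SV (t : R) (n i : ℕ) : Prop := (∃ g ∈ derivedSeries (Iw t) n, PE t i (mm g)) ∧
  (∃ g ∈ derivedSeries (Iw t) n, PF t (i+1) (mm g)) ∧ ∃ g ∈ derivedSeries (Iw t) n, PH t i (mm g)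

lemma comm_mem {n : ℕ} {g h : Iw t} (hg : g ∈ derivedSeries (Iw t) n)
    (hh : h ∈ derivedSeries (Iw t) n) : ⁅g, h⁆ ∈ derivedSeries (Iw t) (n+1) := by
  rw [derivedSeries_succ]; exact Subgroup.commutator_mem_commutator hg hh

lemma gr_EF (ht : ∀ u a : R, IsUnit u → IsUnit (u + t * a))
    {i j : ℕ} {g h : Iw t} (hg : PE t i (mm g)) (hh : PF t j (mm h)) :
    PH t (i+j) (mm ⁅g, h⁆) := by
  obtain ⟨K, hK, e⟩ := mm_comm g h
  rw [e]; exact (br_EF ht hg hh).mul ht hK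

lemma gr_HE (ht : ∀ u a : R, IsUnit u → IsUnit (u + t * a)) (h2 : IsUnit (2:R))
    {i j : ℕ} {g h : Iw t} (hg : PH t i (mm g)) (hh : PE t j (mm h)) :
    PE t (i+j) (mm ⁅g, h⁆) := by
  obtain ⟨K, hK, e⟩ := mm_comm g h
  rw [e]; exact (br_HE ht h2 hg hh).mul ht hK

lemma gr_HF (ht : ∀ u a : R, IsUnit u → IsUnit (u + t * a)) (h2 : IsUnit (2:R))
    {i j : ℕ} {g h : Iw t} (hg : PH t i (mm g)) (hh : PF t j (mm h)) :
    PF t (i+j) (mm ⁅g, h⁆) := by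
  obtain ⟨K, hK, e⟩ := mm_comm g h
  rw [e]; exact (br_HF ht h2 hg hh).mul ht hK

lemma SO.next (ht : ∀ u a : R, IsUnit u → IsUnit (u + t * a)) (h2 : IsUnit (2:R))
    {n i : ℕ} (h : SO t n i) : SV t (n+1) (2*i+1) := by
  obtain ⟨⟨e, he, pe⟩, ⟨f, hf, pf⟩, ⟨k, hk, pk⟩⟩ := h
  refine ⟨⟨_, comm_mem hk he, ?_⟩, ⟨_, comm_mem hk hf, ?_⟩, ⟨_, comm_mem he hf, ?_⟩⟩
  · convert gr_HE ht h2 pk pe using 1; ring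
  · convert gr_HF ht h2 pk pf using 1; ring
  · convert gr_EF ht pe pf using 1; ring

lemma SV.next (ht : ∀ u a : R, IsUnit u → IsUnit (u + t * a)) (h2 : IsUnit (2:R))
    {n i : ℕ} (h : SV t n i) : SO t (n+1) (2*i) := by
  obtain ⟨⟨e, he, pe⟩, ⟨f, hf, pf⟩, ⟨k, hk, pk⟩⟩ := h
  refine ⟨⟨_, comm_mem hk he, ?_⟩, ⟨_, comm_mem hk hf, ?_⟩, ⟨_, comm_mem he hf, ?_⟩⟩
  · convert gr_HE ht h2 pk pe using 1; ring
  · convert gr_HF ht h2 pk pf using 1; ring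
  · convert gr_EF ht pe pf using 1; ring

def eE (t : R) : Iw t := ⟨⟨!![1, 1; 0, 1], by simp⟩, ⟨0, 1, 0, 0, by simp⟩⟩

lemma pE : PE t 0 (mm (eE t)) := ⟨0, 1, 0, 0, isUnit_one, by
  ext a b; fin_cases a <;> fin_cases b <;> simp [mm, eE]⟩

lemma SO.zero (ht : ∀ u a : R, IsUnit u → IsUnit (u + t * a))
    : SO t 0 0 := by
  refine ⟨⟨eE t, by simp, pE⟩, ⟨⟨⟨!![1, 0; t, 1], by simp⟩, ⟨0, 0, 1, 0, by simp⟩⟩, by simp, ?_⟩, ?_⟩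
  · refine ⟨0, 0, 1, 0, isUnit_one, ?_⟩
    ext a b; fin_cases a <;> fin_cases b <;> simp [mm]
  · obtain ⟨v, hv⟩ := ht 1 1 isUnit_one
    have h1 : (1 + t) * (↑v⁻¹ : R) = 1 := by rw [← mul_one t, ← hv]; simp
    have h3 : (↑v⁻¹ : R) = 1 - t * ↑v⁻¹ := by linear_combination h1
    refine ⟨⟨⟨!![1+t, 0; 0, (↑v⁻¹ : R)], by simp [h1]⟩, ⟨1, 0, 0, -↑v⁻¹, ?_⟩⟩, by simp, ?_⟩
    · ext a b; fin_cases a <;> fin_cases b <;> simp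
      linear_combination h3
    · refine ⟨1, 0, 0, ↑v⁻¹, isUnit_one, ?_⟩
      ext a b; fin_cases a <;> fin_cases b <;> simp [mm]
      linear_combination (1 - t) * h3

lemma S_all (ht : ∀ u a : R, IsUnit u → IsUnit (u + t * a)) (h2 : IsUnit (2:R))
    (r : ℕ) : ∃ i, 3*i+2 = 2^(2*r+1) ∧ SO t (2*r) i := by
  induction r with
  | zero => exact ⟨0, by norm_num, SO.zero ht⟩
  | succ r ih =>
    obtain ⟨i, hi, h⟩ := ih
    refine ⟨_, ?_, SV.next ht h2 (SO.next ht h2 h)⟩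
    rw [show 2*(r+1)+1 = 2*r+1+2 by ring, pow_add, ← hi]; ring

end gen

lemma card_Iw (m : ℕ) : Nat.card (Iw (3 : ZMod (3^(m+1)))) = 3^(3*m+1) := by
  set R := ZMod (3^(m+1))
  have hnil : IsNilpotent (3:R) := ⟨m+1, by
    have := ZMod.natCast_self (3^(m+1)); push_cast at this; exact this⟩
  let I := AddSubgroup.zmultiples (3:R)
  have hI : ∀ x, x ∈ I ↔ ∃ a, x = 3 * a := by
    intro x
    constructor
    · rintro ⟨k, rfl⟩; exact ⟨k, by simp [mul_comm]⟩
    · rintro ⟨a, rfl⟩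
      obtain ⟨k, rfl⟩ := ZMod.intCast_surjective a
      exact ⟨k, by simp [mul_comm]⟩
  have cI : Nat.card I = 3^m := by
    rw [Nat.card_zmultiples]
    have := ZMod.addOrderOf_coe 3 (n := 3^(m+1)) (by positivity)
    rw [Nat.gcd_eq_right (dvd_pow_self 3 (by omega)), pow_succ,
      Nat.mul_div_cancel _ (by norm_num)] at this
    exact_mod_cast this
  have hu : ∀ x ∈ I, IsUnit (1 + x) := by
    intro x hx
    obtain ⟨a, rfl⟩ := (hI x).1 hx
    exact ((Commute.all _ _).isNilpotent_mul_right hnil).isUnit_one_add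
  let φ : Iw (3:R) → I × R × I := fun g =>
    (⟨g.1.1 0 0 - 1, by
      obtain ⟨a, b, c, d, h⟩ := g.2
      rw [h]; exact (hI _).2 ⟨a, by simp⟩⟩, g.1.1 0 1, ⟨g.1.1 1 0, by
      obtain ⟨a, b, c, d, h⟩ := g.2
      rw [h]; exact (hI _).2 ⟨c, by simp⟩⟩)
  have hφ : Function.Bijective φ := by
    constructor
    · intro g h e
      simp only [φ, Prod.mk.injEq, Subtype.mk.injEq, sub_left_inj] at e
      obtain ⟨e1, e2, e3⟩ := e
      have dg := g.1.2
      have dh := h.1.2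
      have ug : IsUnit (g.1.1 0 0) := by
        have := hu _ (φ g).1.2
        simpa [φ] using this
      rw [Matrix.det_fin_two] at dg dh
      have e4 : g.1.1 1 1 = h.1.1 1 1 := by
        apply ug.mul_left_cancel
        rw [e1, e2, e3] at dg
        rw [e1]
        linear_combination dg - dh
      apply Subtype.ext; apply Subtype.ext
      ext a b; fin_cases a <;> fin_cases b
      · exact e1
      · exact e2
      · exact e3
      · exact e4
    · rintro ⟨⟨x, hx⟩, b, ⟨c, hc⟩⟩
      obtain ⟨v, hv⟩ := hu x hx
      have h1 : (1 + x) * (↑v⁻¹ : R) = 1 := by rw [← hv]; simp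
      obtain ⟨x', hx'⟩ := (hI _).1 hx
      obtain ⟨c', hc'⟩ := (hI _).1 hc
      refine ⟨⟨⟨!![1+x, b; c, (↑v⁻¹ : R) * (1 + b * c)], ?_⟩,
        ⟨x', b, c', (↑v⁻¹:R) * (b * c' - x'), ?_⟩⟩, ?_⟩
      · rw [Matrix.det_fin_two_of]; linear_combination (1+b*c) * h1
      · subst hx' hc'
        ext a b; fin_cases a <;> fin_cases b <;> simp
        linear_combination h1
      · simp [φ]
  rw [Nat.card_congr (Equiv.ofBijective φ hφ), Nat.card_prod, Nat.card_prod, cI, Nat.card_zmod]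
  ring

lemma finish {G : Type} [Group G] [Finite G] (n d : ℕ) (hc : Nat.card G = 3^n) (hn : n < 2^(d+1))
    (h : derivedSeries G d ≠ ⊥) :
    ∃ (G : Type) (_ : Group G) (_ : Finite G), IsSolvable G ∧ Odd (Nat.card G) ∧
      DerivedLengthEq G (d+1) ∧ Omega (Nat.card G) < 2 ^ (d+1) := by
  have : Fact (Nat.Prime 3) := ⟨Nat.prime_three⟩
  have hp : IsPGroup 3 G := IsPGroup.of_card hc
  have : Group.IsNilpotent G := hp.isNilpotent
  let N := derivedSeries G (d+1)
  have hmap : ∀ k, derivedSeries (G ⧸ N) k = (derivedSeries G k).map (QuotientGroup.mk' N) :=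
    fun k => (map_derivedSeries_eq (QuotientGroup.mk'_surjective N) k).symm
  have key : derivedSeries (G ⧸ N) d ≠ ⊥ := by
    intro hb
    rw [hmap, Subgroup.map_eq_bot_iff, QuotientGroup.ker_mk'] at hb
    have hst : ∀ j, derivedSeries G d ≤ derivedSeries G (d+j) := by
      intro j
      induction j with
      | zero => exact le_rfl
      | succ j ih =>
        refine hb.trans ?_
        rw [← add_assoc]
        simp only [N, derivedSeries_succ]
        exact Subgroup.commutator_mono ih ih
    obtain ⟨s, hs⟩ := (inferInstance : Group.IsSolvable G).solvable
    have h1 := hst s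
    have h2 : derivedSeries G (d+s) ≤ derivedSeries G s := derivedSeries_antitone G (by omega)
    rw [hs] at h2
    exact h (le_bot_iff.1 (h1.trans h2))
  obtain ⟨r, hr, hcard⟩ := (Nat.dvd_prime_pow Nat.prime_three).1
    (hc ▸ Subgroup.card_quotient_dvd_card N)
  refine ⟨G ⧸ N, inferInstance, inferInstance, (inferInstance : Group.IsSolvable (G ⧸ N)), ?_, ⟨?_, ?_⟩, ?_⟩
  · rw [hcard]; exact Odd.pow (by decide)
  · rw [hmap, Subgroup.map_eq_bot_iff, QuotientGroup.ker_mk']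
  · intro k hk hb
    have := derivedSeries_antitone (G ⧸ N) (show k ≤ d by omega)
    rw [hb] at this
    exact key (le_bot_iff.1 this)
  · rw [hcard, Omega, Nat.Prime.primeFactorsList_pow Nat.prime_three, List.length_replicate]
    omega

lemma ht3 (m : ℕ) (u a : ZMod (3^(m+1))) (hu : IsUnit u) : IsUnit (u + 3 * a) := by
  have hnil : IsNilpotent (3 : ZMod (3^(m+1))) := ⟨m+1, by
    have := ZMod.natCast_self (3^(m+1)); push_cast at this; exact this⟩
  exact ((Commute.all _ _).isNilpotent_mul_right hnil).isUnit_add_left_of_commute hu (Commute.all _ _)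

lemma two3 (m : ℕ) : IsUnit (2 : ZMod (3^(m+1))) := by
  have := (ZMod.isUnit_iff_coprime 2 (3^(m+1))).2 (Nat.Coprime.pow_right _ (by norm_num))
  exact_mod_cast this

lemma ne_one_of_PE (m : ℕ) (g : Iw (3 : ZMod (3^(m+1)))) (h : PE 3 m (mm g)) : g ≠ 1 := by
  rintro rfl
  obtain ⟨x, u, z, w, hu, e⟩ := h
  have := congrFun (congrFun e 0) 1
  simp [mm] at this
  have h3 : (3 : ZMod (3^(m+1)))^m = 0 := by
    have h := this.symm
    rwa [hu.mul_left_eq_zero] at h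
  have h4 : ((3^m : ℕ) : ZMod (3^(m+1))) = 0 := by push_cast; exact h3
  rw [ZMod.natCast_eq_zero_iff] at h4
  exact absurd (Nat.le_of_dvd (by positivity) h4) (not_le.2 (Nat.pow_lt_pow_right (by norm_num) (by omega)))

end OddSolv

open OddSolv in
/-- For every `d ≥ 1` there is a finite solvable group `G` of odd order with derived
length exactly `d` and `Ω(|G|) < 2^d`. -/
theorem exists_odd_solvable_comp_length_lt (d : ℕ) (hd : 1 ≤ d) :
    ∃ (G : Type) (_ : Group G) (_ : Finite G), IsSolvable G ∧ Odd (Nat.card G) ∧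
      DerivedLengthEq G d ∧ Omega (Nat.card G) < 2 ^ d := by
  have : Fact (Nat.Prime 3) := ⟨Nat.prime_three⟩
  obtain ⟨n, rfl⟩ : ∃ n, d = n + 1 := ⟨d - 1, by omega⟩
  have hfin : ∀ m, Finite (Iw (3 : ZMod (3^(m+1)))) := fun m =>
    Nat.finite_of_card_ne_zero (by rw [card_Iw]; positivity)
  rcases Nat.even_or_odd' n with ⟨r, rfl | rfl⟩
  · obtain ⟨i, hi⟩ : ∃ i, 3*i+2 = 2^(2*r+1) :=
      let ⟨i, hi, _⟩ := S_all (ht3 0) (two3 0) r; ⟨i, hi⟩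
    obtain ⟨j, hj, ⟨g, hg, pg⟩, -⟩ := S_all (ht3 i) (two3 i) r
    obtain rfl : j = i := by omega
    have := hfin j
    refine finish (3*j+1) (2*r) (card_Iw j) (by omega) ?_
    intro hb
    rw [hb, Subgroup.mem_bot] at hg
    exact ne_one_of_PE j g pg hg
  · obtain ⟨i, hi⟩ : ∃ i, 3*i+2 = 2^(2*r+1) :=
      let ⟨i, hi, _⟩ := S_all (ht3 0) (two3 0) r; ⟨i, hi⟩
    obtain ⟨j, hj, hS⟩ := S_all (ht3 (2*i+1)) (two3 (2*i+1)) r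
    obtain rfl : j = i := by omega
    obtain ⟨-, -, g, hg, pg⟩ := SO.next (ht3 (2*j+1)) (two3 (2*j+1)) hS
    have := hfin (2*j+1)
    have hc := card_Iw (2*j+1)
    let H := Iw (3 : ZMod (3^(2*j+1+1)))
    have hne : ⁅g, eE _⁆ ≠ 1 := ne_one_of_PE (2*j+1) ⁅g, eE _⁆
      (gr_HE (i := 2*j+1) (j := 0) (ht3 (2*j+1)) (two3 (2*j+1)) pg pE)
    have hp : IsPGroup 3 H := IsPGroup.of_card hc
    have : Nontrivial H := ⟨_, _, hne⟩
    have := hp.center_nontrivial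
    have hz : 1 < Nat.card (Subgroup.center H) := Finite.one_lt_card
    have hmul := Subgroup.card_eq_card_quotient_mul_card_subgroup (Subgroup.center H)
    obtain ⟨s, hs, hcard⟩ := (Nat.dvd_prime_pow Nat.prime_three).1
      (hc ▸ Subgroup.card_quotient_dvd_card (Subgroup.center H))
    have hlt : s < 3*(2*j+1)+1 := by
      apply lt_of_le_of_ne hs
      rintro rfl
      rw [hc, hcard] at hmul
      have : 0 < 3^(3*(2*j+1)+1) := by positivity
      nlinarith
    refine finish s (2*r+1) hcard (by rw [pow_succ, ← hi]; omega) ?_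
    intro hb
    rw [← map_derivedSeries_eq (QuotientGroup.mk'_surjective (Subgroup.center H)),
      Subgroup.map_eq_bot_iff, QuotientGroup.ker_mk'] at hb
    have := Subgroup.mem_center_iff.1 (hb hg) (eE _)
    exact hne (commutatorElement_eq_one_iff_mul_comm.2 this.symm)
end

section
/- Let d ≥ 1 and let P be a Sylow 2-subgroup of the symmetric group on 2^d letters (so P is isomorphic to the d-fold iterated wreath product S₂ wr ⋯ wr S₂). Then every proper subgroup of P has derived length strictly less than d. -/
section helpers

theorem ds_joint {G : Type*} [Group G] {ι : Type*} {A : ι → Type*} [∀ i, Group (A i)]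
    (f : ∀ i, G →* A i) (hf : ∀ x, (∀ i, f i x = 1) → x = 1) (n : ℕ)
    (h : ∀ i, derivedSeries (A i) n = ⊥) : derivedSeries G n = ⊥ := by
  rw [eq_bot_iff]
  intro x hx
  rw [Subgroup.mem_bot]
  refine hf x fun i => ?_
  have := map_derivedSeries_le_derivedSeries (f i) n (Subgroup.mem_map_of_mem (f i) hx)
  rwa [h i, Subgroup.mem_bot] at this

theorem ds_inj {G A : Type*} [Group G] [Group A] (f : G →* A) (hf : Function.Injective f) (n : ℕ)
    (h : derivedSeries A n = ⊥) : derivedSeries G n = ⊥ :=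
  ds_joint (ι := Unit) (A := fun _ => A) (fun _ => f)
    (fun x hx => hf (by rw [hx (), map_one])) n (fun _ => h)

theorem ds_comm {G : Type*} [Group G] (K : Subgroup G) (hK : ∀ a b : G, a * b * a⁻¹ * b⁻¹ ∈ K) (n : ℕ)
    (h : derivedSeries K n = ⊥) : derivedSeries G (n + 1) = ⊥ := by
  have key : ∀ m, derivedSeries G (m + 1) ≤ (derivedSeries K m).map K.subtype := by
    intro m
    induction m with
    | zero =>
      rw [derivedSeries_succ, Subgroup.commutator_le]
      intro a _ b _
      exact ⟨⟨_, hK a b⟩, by simp, rfl⟩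
    | succ m ih =>
      rw [derivedSeries_succ, derivedSeries_succ (G := K), Subgroup.map_commutator]
      exact Subgroup.commutator_mono ih ih
  have := key n
  rw [h, Subgroup.map_bot] at this
  exact le_bot_iff.mp this

variable {D : Type*} [Group D]

open RegularWreathProduct

/-- Projection of a subgroup of the base group onto a coordinate. -/
def baseProj (K : Subgroup (D ≀ᵣ ℤˣ)) (hK : ∀ w ∈ K, w.right = 1) (t : ℤˣ) : K →* D where
  toFun w := w.1.left t
  map_one' := rfl
  map_mul' a b := by simp [hK a.1 a.2]

theorem base_ds (K : Subgroup (D ≀ᵣ ℤˣ)) (hK : ∀ w ∈ K, w.right = 1) (n : ℕ)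
    (h : derivedSeries D n = ⊥) : derivedSeries K n = ⊥ := by
  refine ds_joint (fun t => baseProj K hK t) (fun x hx => ?_) n (fun _ => h)
  apply Subtype.ext
  apply RegularWreathProduct.ext
  · funext t; exact hx t
  · exact hK _ x.2

theorem wr_ds (n : ℕ) (h : derivedSeries D n = ⊥) : derivedSeries (D ≀ᵣ ℤˣ) (n + 1) = ⊥ := by
  refine ds_comm (rightHom : D ≀ᵣ ℤˣ →* ℤˣ).ker (fun a b => ?_) n
    (base_ds _ (fun w hw => hw) n h)
  simp only [MonoidHom.mem_ker, map_mul, map_inv]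
  rw [mul_comm (rightHom a)]
  group

/-- Coordinate embedding. -/
def coordEmb : D →* D ≀ᵣ ℤˣ where
  toFun x := ⟨fun t => if t = 1 then x else 1, 1⟩
  map_one' := by ext <;> simp
  map_mul' a b := by
    ext t
    · by_cases h : t = 1 <;> simp [h]
    · simp

theorem units_cases (t : ℤˣ) : t = 1 ∨ t = -1 := Int.units_eq_one_or t

theorem decomp (w : D ≀ᵣ ℤˣ) :
    w = coordEmb (w.left 1) * (inl (-1) * coordEmb (w.left (-1)) * inl (-1)) * inl w.right := by
  ext t
  · rcases units_cases t with rfl | rfl <;> simp [coordEmb]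
  · simp [coordEmb]

theorem chi_formula (χ : D ≀ᵣ ℤˣ →* ℤˣ) (w : D ≀ᵣ ℤˣ) :
    χ w = χ (coordEmb (w.left 1)) * χ (coordEmb (w.left (-1))) * χ (inl w.right) := by
  conv_lhs => rw [decomp w]
  simp only [map_mul]
  rcases units_cases (χ (inl (-1))) with h | h <;> simp [h]

theorem step (n : ℕ) (h0 : derivedSeries D (n + 1) = ⊥)
    (h1 : ∀ χ : D →* ℤˣ, χ ≠ 1 → derivedSeries χ.ker n = ⊥)
    (χ : D ≀ᵣ ℤˣ →* ℤˣ) (hχ : χ ≠ 1) : derivedSeries χ.ker (n + 1) = ⊥ := by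
  by_cases hc : χ.comp coordEmb = 1
  · have hc' : ∀ x, χ (coordEmb x) = 1 := fun x => DFunLike.congr_fun hc x
    refine base_ds _ (fun w hw => ?_) _ h0
    by_contra hr
    have hr' : w.right = -1 := (units_cases _).resolve_left hr
    apply hχ
    rw [MonoidHom.mem_ker, chi_formula, hc', hc', hr'] at hw
    ext v
    rw [chi_formula, hc', hc']
    rcases units_cases v.right with h | h
    · simp [h]
    · rw [h]; simpa using hw
  · set ψ := χ.comp coordEmb with hψ
    have hf : ∀ w : D ≀ᵣ ℤˣ, χ w = ψ (w.left 1) * ψ (w.left (-1)) * χ (inl w.right) :=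
      chi_formula χ
    let K : Subgroup χ.ker :=
      { carrier := {w | w.1.right = 1 ∧ ∀ t, ψ (w.1.left t) = 1}
        one_mem' := by simp
        mul_mem' := by
          rintro a b ⟨ha, ha'⟩ ⟨hb, hb'⟩
          exact ⟨by simp [ha, hb], fun t => by simp [ha, ha', hb']⟩
        inv_mem' := by
          rintro a ⟨ha, ha'⟩
          exact ⟨by simp [ha], fun t => by simp [ha, ha']⟩ }
    refine ds_comm K ?_ n ?_
    · rintro ⟨a, ha⟩ ⟨b, hb⟩
      rw [MonoidHom.mem_ker, hf] at ha hb
      refine ⟨?_, fun t => ?_⟩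
      · change a.right * b.right * a.right⁻¹ * b.right⁻¹ = 1
        rw [mul_comm a.right]
        group
      · simp only [Subgroup.coe_mul, Subgroup.coe_inv, mul_left, mul_right,
          inv_left, inv_right, Pi.mul_apply, Pi.inv_apply, map_mul, map_inv]
        rcases units_cases a.right with har | har <;> rcases units_cases b.right with hbr | hbr <;>
        rcases units_cases t with rfl | rfl <;>
        rw [har] at ha ⊢ <;> rw [hbr] at hb ⊢ <;>
        rcases units_cases (ψ (a.left 1)) with p1 | p1 <;>
        rcases units_cases (ψ (a.left (-1))) with p2 | p2 <;>
        rcases units_cases (ψ (b.left 1)) with p3 | p3 <;>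
        rcases units_cases (ψ (b.left (-1))) with p4 | p4 <;>
        rcases units_cases (χ (inl (-1))) with p5 | p5 <;>
        simp [p1, p2, p3, p4, p5] at ha hb ⊢
    · refine ds_joint (A := fun _ : ℤˣ => ψ.ker) (fun t =>
        { toFun := fun w => ⟨w.1.1.left t, w.2.2 t⟩
          map_one' := rfl
          map_mul' := fun a b => by
            apply Subtype.ext
            simp [a.2.1] }) (fun x hx => ?_) n (fun _ => h1 ψ hc)
      apply Subtype.ext
      apply Subtype.ext
      apply RegularWreathProduct.ext
      · funext t; exact congrArg Subtype.val (hx t)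
      · exact x.2.1

theorem iter_full (n : ℕ) : derivedSeries (IteratedWreathProduct ℤˣ n) n = ⊥ := by
  induction n with
  | zero =>
    rw [eq_bot_iff]
    rintro ⟨⟩ _
    rfl
  | succ n ih => exact wr_ds n ih

theorem iter_ker (n : ℕ) (χ : IteratedWreathProduct ℤˣ (n + 1) →* ℤˣ) (hχ : χ ≠ 1) :
    derivedSeries χ.ker n = ⊥ := by
  induction n with
  | zero =>
    rw [eq_bot_iff]
    rintro ⟨⟨l, r⟩, hx⟩ _
    rw [Subgroup.mem_bot]
    apply Subtype.ext
    rcases units_cases r with rfl | rfl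
    · rfl
    · exfalso
      apply hχ
      ext ⟨l', r'⟩
      rcases units_cases r' with rfl | rfl
      · have : (⟨l', 1⟩ : IteratedWreathProduct ℤˣ 1) = 1 := rfl
        rw [this]; exact congrArg Units.val (map_one χ)
      · have h2 : χ ⟨l, -1⟩ = 1 := hx
        have : l' = l := funext fun _ => PUnit.ext _ _
        rw [this, h2]; rfl
  | succ n ih => exact step n (iter_full (n + 1)) ih χ hχ

theorem exists_char {G : Type*} [Group G] [Finite G] (hG : IsPGroup 2 G) (H : Subgroup G)
    (hH : H ≠ ⊤) : ∃ χ : G →* ℤˣ, χ ≠ 1 ∧ H ≤ χ.ker := by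
  have : Fact (Nat.Prime 2) := ⟨Nat.prime_two⟩
  obtain ⟨N, hN⟩ := IsPGroup.iff_card.mp hG
  obtain ⟨k, hk⟩ := IsPGroup.iff_card.mp (hG.to_subgroup H)
  have hlt : k < N := by
    have hle : Nat.card H ≤ Nat.card G := Subgroup.card_le_card_group H
    have hne : Nat.card H ≠ Nat.card G := fun h => hH (Subgroup.eq_top_of_card_eq H h)
    have := lt_of_le_of_ne hle hne
    rw [hk, hN] at this
    exact (Nat.pow_lt_pow_iff_right (by norm_num)).mp this
  obtain ⟨m, rfl⟩ : ∃ m, N = m + 1 := ⟨N - 1, by omega⟩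
  obtain ⟨K, hK, hHK⟩ := Sylow.exists_subgroup_card_pow_prime_le 2
    (n := k) (m := m) (by rw [hN]; exact pow_dvd_pow 2 (by omega)) H hk (by omega)
  have hidx : K.index = 2 := by
    have := K.card_mul_index
    rw [hK, hN, pow_succ] at this
    exact Nat.eq_of_mul_eq_mul_left (by positivity) this
  have := Subgroup.normal_of_index_eq_two hidx
  have hq : Nat.card (G ⧸ K) = 2 := hidx
  have hu : Nat.card ℤˣ = 2 := by simp
  let e : G ⧸ K ≃* ℤˣ := mulEquivOfPrimeCardEq hq hu
  have hker : (e.toMonoidHom.comp (QuotientGroup.mk' K)).ker = K := by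
    ext x
    simp [MonoidHom.mem_ker]
  refine ⟨e.toMonoidHom.comp (QuotientGroup.mk' K), fun h => ?_, hker.symm ▸ hHK⟩
  rw [h, MonoidHom.ker_one] at hker
  rw [← hker] at hidx
  simp at hidx

end helpers

/-- Every proper subgroup of a Sylow `2`-subgroup of the symmetric group on `2^d` letters
(i.e. of the `d`-fold iterated wreath product `S₂ wr ⋯ wr S₂`) has derived length
strictly less than `d`. -/
theorem proper_subgroup_derived_length_lt (d : ℕ) (hd : 1 ≤ d)
    (P : Sylow 2 (Equiv.Perm (Fin (2 ^ d))))
    (H : Subgroup (P : Subgroup (Equiv.Perm (Fin (2 ^ d))))) (hH : H ≠ ⊤) :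
    ∃ k < d, derivedSeries H k = ⊥ := by
  obtain ⟨n, rfl⟩ : ∃ n, d = n + 1 := ⟨d - 1, by omega⟩
  refine ⟨n, by omega, ?_⟩
  have : Fact (Nat.Prime 2) := ⟨Nat.prime_two⟩
  obtain ⟨χ, hχ, hle⟩ := exists_char P.isPGroup' H hH
  let e := Sylow.mulEquivIteratedWreathProduct 2 (n + 1) (Fin (2 ^ (n + 1))) (by simp)
    ℤˣ (by simp) P
  let χ' := χ.comp e.symm.toMonoidHom
  have hχ' : χ' ≠ 1 := by
    intro h
    apply hχ
    ext x
    have := DFunLike.congr_fun h (e x)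
    change χ (e.symm (e x)) = 1 at this
    rw [e.symm_apply_apply] at this
    rw [this]; rfl
  have hm : ∀ x : H, e x.1 ∈ χ'.ker := by
    intro x
    have := hle x.2
    rw [MonoidHom.mem_ker] at this ⊢
    change χ (e.symm (e x.1)) = 1
    rwa [e.symm_apply_apply]
  exact ds_inj ((e.toMonoidHom.comp H.subtype).codRestrict χ'.ker hm)
    (fun a b h => Subtype.ext (e.injective (congrArg Subtype.val h))) n (iter_ker n χ' hχ')
end

section
/- For every integer r ≥ 1 and every k ∈ {1, 2, 3, 4}, there exists a finite solvable group G with derived length exactly 5r + k and Ω(|G|) = (a_k·9^r − 7)/8, where a₁ = 15, a₂ = 23, a₃ = 39, a₄ = 47, and Ω(|G|) is the number of prime factors of |G| counted with multiplicity. (Such groups are the wreath products S₂ wr G_m, S₃ wr G_m, S₄ wr G_m and GL(2,3) wr G_m, where G_m is the r-fold iterated wreath product of G₉ = F₃² ⋊ GL(2, F₃).) -/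
open Matrix
open scoped commutatorElement

namespace Wr

/-! ### General facts about derived series -/

theorem derived_le_map {N G : Type*} [Group N] [Group G] (i : N →* G) {n : ℕ}
    (h : derivedSeries G n ≤ i.range) (m : ℕ) :
    derivedSeries G (n + m) ≤ (derivedSeries N m).map i := by
  induction m with
  | zero => simpa [← MonoidHom.range_eq_map] using h
  | succ m ih =>
    rw [← add_assoc, derivedSeries_succ, derivedSeries_succ, Subgroup.map_commutator]
    exact Subgroup.commutator_mono ih ih

theorem map_le_derived {N G : Type*} [Group N] [Group G] (i : N →* G) {n : ℕ}
    (h : i.range ≤ derivedSeries G n) (m : ℕ) :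
    (derivedSeries N m).map i ≤ derivedSeries G (n + m) := by
  induction m with
  | zero => simpa [← MonoidHom.range_eq_map] using h
  | succ m ih =>
    rw [← add_assoc, derivedSeries_succ, derivedSeries_succ, Subgroup.map_commutator]
    exact Subgroup.commutator_mono ih ih

theorem hom_mem {N G : Type*} [Group N] [Group G] (i : N →* G) {n : ℕ} {x : N}
    (h : x ∈ derivedSeries N n) : i x ∈ derivedSeries G n :=
  map_derivedSeries_le_derivedSeries i n (Subgroup.mem_map_of_mem i h)

theorem comm_mem {G : Type*} [Group G] {n : ℕ} {x y : G} (hx : x ∈ derivedSeries G n)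
    (hy : y ∈ derivedSeries G n) : ⁅x, y⁆ ∈ derivedSeries G (n + 1) := by
  rw [derivedSeries_succ]
  exact Subgroup.commutator_mem_commutator hx hy

theorem derivedLengthEq_of {G : Type*} [Group G] {d : ℕ} (h1 : derivedSeries G (d + 1) = ⊥)
    (h2 : derivedSeries G d ≠ ⊥) : DerivedLengthEq G (d + 1) := by
  refine ⟨h1, fun k hk hb => h2 ?_⟩
  exact le_bot_iff.1 (hb ▸ derivedSeries_antitone G (Nat.lt_succ_iff.1 hk))

theorem ne_bot_of_mem {G : Type*} [Group G] {H : Subgroup G} {x : G} (hx : x ∈ H) (h : x ≠ 1) :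
    H ≠ ⊥ := by
  rintro rfl
  exact h (Subgroup.mem_bot.1 hx)

open ArithmeticFunction in
theorem Omega_two_three (a b : ℕ) : Omega (2 ^ a * 3 ^ b) = a + b := by
  change cardFactors _ = _
  rw [cardFactors_mul (by positivity) (by positivity),
    cardFactors_apply_prime_pow Nat.prime_two, cardFactors_apply_prime_pow Nat.prime_three]

/-! ### The groups `SL(2,3)` and `GL(2,3)` -/

abbrev S := SpecialLinearGroup (Fin 2) (ZMod 3)
abbrev L := GL (Fin 2) (ZMod 3)
abbrev V := Fin 2 → ZMod 3

def ms : S := ⟨!![1, 1; 0, 1], by decide⟩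
def mt : S := ⟨!![1, 0; 1, 1], by decide⟩
def mi : S := ⟨!![0, 2; 1, 0], by decide⟩
def mj : S := ⟨!![1, 1; 1, 2], by decide⟩
def mneg : S := ⟨!![2, 0; 0, 2], by decide⟩
def md : L := ⟨!![1, 0; 0, 2], !![1, 0; 0, 2], by decide, by decide⟩

theorem comm_st : ⁅ms, mt⁆ = mi := by decide +kernel
theorem comm_stt : ⁅ms, mt * mt⁆ = mj := by decide +kernel
theorem comm_ij : ⁅mi, mj⁆ = mneg := by decide +kernel

/-- The predicate cutting out the quaternion subgroup. -/
def IsQ (M : Matrix (Fin 2) (Fin 2) (ZMod 3)) : Prop :=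
  (M 0 1 = 0 ∧ M 1 0 = 0 ∧ M 0 0 = M 1 1) ∨ M 0 0 + M 1 1 = 0

def IsZ (M : Matrix (Fin 2) (Fin 2) (ZMod 3)) : Prop :=
  M 0 1 = 0 ∧ M 1 0 = 0 ∧ M 0 0 = M 1 1

instance : DecidablePred IsQ := fun M => by unfold IsQ; infer_instance
instance : DecidablePred IsZ := fun M => by unfold IsZ; infer_instance

theorem q_mul (a b : S) (ha : IsQ a) (hb : IsQ b) : IsQ (a * b : S) := by
  revert a b; decide +kernel
theorem q_inv (a : S) (ha : IsQ a) : IsQ (a⁻¹ : S) := by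
  revert a; decide +kernel
theorem q_comm (a b : S) : IsQ (⁅a, b⁆ : S) := by
  revert a b; decide +kernel
theorem z_comm (a b : S) (ha : IsQ a) (hb : IsQ b) : IsZ (⁅a, b⁆ : S) := by
  revert a b; decide +kernel
theorem z_mul (a b : S) (ha : IsZ a) (hb : IsZ b) : IsZ (a * b : S) := by
  revert a b; decide +kernel
theorem z_inv (a : S) (ha : IsZ a) : IsZ (a⁻¹ : S) := by
  revert a; decide +kernel
theorem z_comm_one (a b : S) (ha : IsZ a) (hb : IsZ b) : ⁅a, b⁆ = 1 := by
  revert a b; decide +kernel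
theorem card_S : Nat.card S = 24 := by
  rw [Nat.card_eq_fintype_card]; decide +kernel

def Q8 : Subgroup S where
  carrier := {a | IsQ a}
  mul_mem' {a b} ha hb := q_mul a b ha hb
  one_mem' := by simp [IsQ]
  inv_mem' {a} ha := q_inv a ha

def Z2 : Subgroup S where
  carrier := {a | IsZ a}
  mul_mem' {a b} ha hb := z_mul a b ha hb
  one_mem' := by simp [IsZ]
  inv_mem' {a} ha := z_inv a ha

theorem S_three : derivedSeries S 3 = ⊥ := by
  have h1 : derivedSeries S 1 ≤ Q8 := by
    rw [derivedSeries_succ]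
    exact Subgroup.commutator_le.2 fun a _ b _ => q_comm a b
  have h2 : derivedSeries S 2 ≤ Z2 := by
    rw [derivedSeries_succ]
    exact Subgroup.commutator_le.2 fun a ha b hb => z_comm a b (h1 ha) (h1 hb)
  rw [eq_bot_iff, derivedSeries_succ]
  exact Subgroup.commutator_le.2 fun a ha b hb =>
    Subgroup.mem_bot.2 (z_comm_one a b (h2 ha) (h2 hb))

theorem S_two : mneg ∈ derivedSeries S 2 := by
  have h1 : mi ∈ derivedSeries S 1 := comm_st ▸ comm_mem (n := 0) trivial trivial
  have h2 : mj ∈ derivedSeries S 1 := comm_stt ▸ comm_mem (n := 0) trivial trivial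
  exact comm_ij ▸ comm_mem h1 h2

theorem S_length : DerivedLengthEq S 3 :=
  derivedLengthEq_of S_three (ne_bot_of_mem S_two (by decide))

def toL : S →* L := SpecialLinearGroup.toGL

theorem L_four : derivedSeries L 4 = ⊥ := by
  have h : derivedSeries L 1 ≤ toL.range := by
    rw [derivedSeries_succ]
    refine Subgroup.commutator_le.2 fun a _ b _ => ?_
    have hd : Matrix.det ((⁅a, b⁆ : L) : Matrix (Fin 2) (Fin 2) (ZMod 3)) = 1 := by
      have h : GeneralLinearGroup.det ⁅a, b⁆ = 1 := by
        rw [map_commutatorElement]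
        exact commutatorElement_eq_one_iff_mul_comm.2 (mul_comm _ _)
      exact congrArg Units.val h
    refine ⟨⟨_, hd⟩, ?_⟩
    ext i j
    rfl
  have h2 := derived_le_map toL h 3
  rw [S_three, Subgroup.map_bot] at h2
  exact le_bot_iff.1 h2

theorem comm_ds : ⁅md, toL ms⁆ = toL ms := by
  rw [commutatorElement_def, mul_inv_eq_iff_eq_mul, mul_inv_eq_iff_eq_mul]
  ext i j
  revert i j
  decide +kernel
theorem comm_dt : ⁅md, toL mt⁆ = toL mt := by
  rw [commutatorElement_def, mul_inv_eq_iff_eq_mul, mul_inv_eq_iff_eq_mul]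
  ext i j
  revert i j
  decide +kernel

theorem L_three : toL mneg ∈ derivedSeries L 3 := by
  have hs : toL ms ∈ derivedSeries L 1 := by
    have := comm_mem (n := 0) (x := md) (y := toL ms) trivial trivial
    rwa [comm_ds] at this
  have ht : toL mt ∈ derivedSeries L 1 := by
    have := comm_mem (n := 0) (x := md) (y := toL mt) trivial trivial
    rwa [comm_dt] at this
  have hi : toL mi ∈ derivedSeries L 2 := by
    rw [← comm_st, map_commutatorElement]
    exact comm_mem hs ht
  have hj : toL mj ∈ derivedSeries L 2 := by
    rw [← comm_stt, map_commutatorElement, map_mul]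
    exact comm_mem hs (mul_mem ht ht)
  rw [← comm_ij, map_commutatorElement]
  exact comm_mem hi hj

theorem toL_mneg : toL mneg = -1 := by
  apply Units.ext
  change (!![2, 0; 0, 2] : Matrix (Fin 2) (Fin 2) (ZMod 3)) = -1
  decide +kernel

theorem neg_ne_one : (-1 : L) ≠ 1 := by
  intro h
  have := congrArg (fun g : L => g 0 0) h
  revert this
  decide +kernel

theorem L_length : DerivedLengthEq L 4 :=
  derivedLengthEq_of L_four (ne_bot_of_mem L_three (by rw [toL_mneg]; exact neg_ne_one))

theorem card_L : Nat.card L = 48 := by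
  have : Fact (Nat.Prime 3) := ⟨by norm_num⟩
  rw [Matrix.card_GL_field]
  simp [Fin.prod_univ_succ]

/-! ### The affine group -/

def linAct : L →* MulAut (Multiplicative V) where
  toFun g :=
    { toFun := fun v => Multiplicative.ofAdd (g.1 *ᵥ v.toAdd)
      invFun := fun v => Multiplicative.ofAdd ((g⁻¹).1 *ᵥ v.toAdd)
      left_inv := fun v => by
        have : (g⁻¹).1 * g.1 = 1 := g.inv_mul
        simp only [toAdd_ofAdd, mulVec_mulVec, this, one_mulVec, ofAdd_toAdd]
      right_inv := fun v => by
        have : g.1 * (g⁻¹).1 = 1 := g.mul_inv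
        simp only [toAdd_ofAdd, mulVec_mulVec, this, one_mulVec, ofAdd_toAdd]
      map_mul' := fun v w => by
        simp only [toAdd_mul, mulVec_add, ofAdd_add] }
  map_one' := by
    ext1 v
    change Multiplicative.ofAdd ((1 : Matrix (Fin 2) (Fin 2) (ZMod 3)) *ᵥ v.toAdd) = v
    simp
  map_mul' g h := by
    ext1 v
    change Multiplicative.ofAdd ((g.1 * h.1) *ᵥ v.toAdd) =
      Multiplicative.ofAdd (g.1 *ᵥ (h.1 *ᵥ v.toAdd))
    rw [mulVec_mulVec]

theorem linAct_apply (g : L) (v : Multiplicative V) :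
    linAct g v = Multiplicative.ofAdd (g.1 *ᵥ v.toAdd) := rfl

abbrev Y := Multiplicative V ⋊[linAct] L

instance : MulAction Y V where
  smul y v := y.left.toAdd + y.right.1 *ᵥ v
  one_smul v := by
    change (0 : V) + (1 : Matrix (Fin 2) (Fin 2) (ZMod 3)) *ᵥ v = v
    simp
  mul_smul y z v := by
    change (y.left.toAdd + y.right.1 *ᵥ z.left.toAdd) + (y.right.1 * z.right.1) *ᵥ v =
      y.left.toAdd + y.right.1 *ᵥ (z.left.toAdd + z.right.1 *ᵥ v)
    rw [mulVec_add, mulVec_mulVec, add_assoc]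

theorem Y_smul (y : Y) (v : V) : y • v = y.left.toAdd + y.right.1 *ᵥ v := rfl

def tr (v : V) : Y := SemidirectProduct.inl (Multiplicative.ofAdd v)
def ng : Y := SemidirectProduct.inr (-1)

theorem tr_smul (v w : V) : tr v • w = v + w := by
  rw [Y_smul]; simp [tr]

theorem ng_smul (w : V) : ng • w = -w := by
  rw [Y_smul]; simp [ng, neg_mulVec]

theorem comm_semi {N G : Type*} [Group N] [Group G] {φ : G →* MulAut N} (b : N) (y : G) :
    ⁅(SemidirectProduct.inl b : N ⋊[φ] G), (SemidirectProduct.inr y : N ⋊[φ] G)⁆ =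
      SemidirectProduct.inl (b * (φ y b)⁻¹) := by
  rw [commutatorElement_def, map_mul, ← map_inv (φ y), SemidirectProduct.inl_aut]
  simp [mul_assoc]

theorem three_V (v : V) : v + v + v = 0 := by
  revert v; decide +kernel

theorem ng_mem {n : ℕ} (hn : n ≤ 3) : ng ∈ derivedSeries Y n := by
  have h := L_three
  rw [toL_mneg] at h
  exact derivedSeries_antitone Y hn (hom_mem (SemidirectProduct.inr : L →* Y) h)

theorem tr_comm (v : V) : ⁅tr (-v), ng⁆ = tr v := by
  unfold tr ng
  rw [comm_semi]
  congr 1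
  rw [linAct_apply]
  apply Multiplicative.toAdd.injective
  simp [neg_mulVec]
  have := three_V v
  grind

theorem tr_mem {n : ℕ} (hn : n ≤ 4) (v : V) : tr v ∈ derivedSeries Y n := by
  induction n generalizing v with
  | zero => trivial
  | succ n ih =>
    rw [← tr_comm]
    exact comm_mem (ih (by omega) _) (ng_mem (by omega))

theorem Y_five : derivedSeries Y 5 = ⊥ := by
  have h : derivedSeries Y 4 ≤ (SemidirectProduct.inl : Multiplicative V →* Y).range := by
    rw [SemidirectProduct.range_inl_eq_ker_rightHom]
    intro y hy
    have := hom_mem (SemidirectProduct.rightHom : Y →* L) hy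
    rw [L_four] at this
    exact this
  have h2 := derived_le_map _ h 1
  have h3 : derivedSeries (Multiplicative V) 1 = ⊥ := by
    rw [derivedSeries_one]
    exact (commutator_eq_bot_iff_center_eq_top _).2 CommGroup.center_eq_top
  rw [h3, Subgroup.map_bot] at h2
  exact le_bot_iff.1 h2

theorem card_V : Nat.card V = 9 := by
  simp [Nat.card_eq_fintype_card]

theorem card_Y : Nat.card Y = 432 := by
  rw [SemidirectProduct.card, card_L]
  have : Nat.card (Multiplicative V) = 9 := card_V
  rw [this]

/-! ### The wreath product -/

section wreath
variable (X : Type) [Group X]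

abbrev W := (V → X) ⋊[(mulAutArrow : Y →* MulAut (V → X))] Y

variable {X}

theorem comm_W (b : V → X) (y : Y) :
    ⁅(SemidirectProduct.inl b : W X), (SemidirectProduct.inr y : W X)⁆ =
      SemidirectProduct.inl (fun w => b w * (b (y⁻¹ • w))⁻¹) := by
  rw [comm_semi]
  rfl

def e (x : X) (p q : V) : V → X := fun w => if w = p then x else if w = q then x⁻¹ else 1

theorem e_mem {n : ℕ} (hn : n ≤ 4) (x : X) (p q : V) (hpq : p ≠ q) :
    (SemidirectProduct.inl (e x p q) : W X) ∈ derivedSeries (W X) n := by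
  induction n generalizing x p q with
  | zero => trivial
  | succ n ih =>
    have hp := three_V p
    have hq := three_V q
    have hm : p ≠ -(p + q) := by
      intro h
      apply hpq
      grind
    have hm' : q ≠ -(p + q) := by
      intro h
      apply hpq
      grind
    have key := comm_mem (ih (by omega) x p (-(p + q)) hm)
      (hom_mem (SemidirectProduct.inr : Y →* W X)
        (mul_mem (tr_mem (n := n) (by omega) (p + q)) (ng_mem (n := n) (by omega))))
    rw [comm_W] at key
    convert key using 2
    funext w
    have hy : (tr (p + q) * ng)⁻¹ • w = p + q - w := by
      rw [inv_smul_eq_iff, mul_smul, ng_smul, tr_smul]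
      abel
    rw [hy]
    have h1 : p + q - w = p ↔ w = q := by
      constructor <;> intro h <;> grind
    have h2 : p + q - w = -(p + q) ↔ w = -(p + q) := by
      have hw := three_V w
      constructor <;> intro h <;> grind
    simp only [e, h1, h2]
    generalize -(p + q) = m at hm hm'
    by_cases c1 : w = p
    · subst c1
      simp [hpq, hm]
    · by_cases c2 : w = q
      · subst c2
        simp [c1, hm']
      · by_cases c3 : w = m <;> simp [c1, c2, c3]
        subst c3
        simp [c1, c2]

theorem W_le : derivedSeries (W X) 5 ≤ (SemidirectProduct.inl : (V → X) →* W X).range := by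
  rw [SemidirectProduct.range_inl_eq_ker_rightHom]
  intro y hy
  have := hom_mem (SemidirectProduct.rightHom : W X →* Y) hy
  rw [Y_five] at this
  exact this

theorem W_upper {m : ℕ} (h : derivedSeries X m = ⊥) : derivedSeries (W X) (5 + m) = ⊥ := by
  have h2 := derived_le_map _ (W_le (X := X)) m
  have h3 : derivedSeries (V → X) m = ⊥ := by
    rw [eq_bot_iff]
    intro b hb
    rw [Subgroup.mem_bot]
    funext v
    have := hom_mem (Pi.evalMonoidHom (fun _ : V => X) v) hb
    rw [h] at this
    exact this
  rw [h3, Subgroup.map_bot] at h2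
  exact le_bot_iff.1 h2

theorem W_proj (x : X) : ∃ b : V → X, b 0 = x ∧
    (SemidirectProduct.inl b : W X) ∈ derivedSeries (W X) 5 := by
  have hq : (0 : V) ≠ 1 := by decide
  have key := comm_mem (e_mem (n := 4) le_rfl x 0 1 hq)
    (hom_mem (SemidirectProduct.inr : Y →* W X) (tr_mem (n := 4) le_rfl 1))
  rw [comm_W] at key
  refine ⟨_, ?_, key⟩
  have hy : (tr 1)⁻¹ • (0 : V) = -1 := by
    rw [inv_smul_eq_iff, tr_smul]
    decide
  have h1 : (-1 : V) ≠ 0 := by decide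
  have h2 : (-1 : V) ≠ 1 := by decide
  simp only [hy]
  simp [e, h2]

theorem W_lower {m : ℕ} (h : derivedSeries (W X) (5 + m) = ⊥) : derivedSeries X m = ⊥ := by
  let K : Subgroup (V → X) :=
    (derivedSeries (W X) 5).comap (SemidirectProduct.inl : (V → X) →* W X)
  let i : K →* W X := SemidirectProduct.inl.comp K.subtype
  have hi : Function.Injective i :=
    SemidirectProduct.inl_injective.comp K.subtype_injective
  have h1 : i.range ≤ derivedSeries (W X) 5 := by
    rintro _ ⟨b, rfl⟩
    exact b.2
  have h2 := map_le_derived i h1 m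
  rw [h, le_bot_iff, Subgroup.map_eq_bot_iff_of_injective _ hi] at h2
  let f : K →* X := (Pi.evalMonoidHom (fun _ : V => X) 0).comp K.subtype
  have hf : Function.Surjective f := by
    intro x
    obtain ⟨b, hb, hm⟩ := W_proj x
    exact ⟨⟨b, hm⟩, hb⟩
  rw [← map_derivedSeries_eq hf, h2, Subgroup.map_bot]

theorem W_length {d : ℕ} (h : DerivedLengthEq X (d + 1)) :
    DerivedLengthEq (W X) (5 + d + 1) :=
  derivedLengthEq_of (W_upper h.1) fun hb => h.2 d (Nat.lt_succ_self d) (W_lower hb)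

instance : Finite Y := Nat.finite_of_card_ne_zero (by rw [card_Y]; norm_num)

theorem W_finite [Finite X] : Finite (W X) :=
  Finite.of_equiv _ SemidirectProduct.equivProd.symm

open ArithmeticFunction in
theorem W_Omega [Finite X] : Omega (Nat.card (W X)) = 9 * Omega (Nat.card X) + 7 := by
  rw [SemidirectProduct.card, Nat.card_fun, card_Y, card_V]
  change cardFactors _ = 9 * cardFactors _ + 7
  have h0 : Nat.card X ≠ 0 := Nat.card_pos.ne'
  rw [cardFactors_mul (pow_ne_zero _ h0) (by norm_num), cardFactors_pow]
  have : cardFactors 432 = 7 := by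
    exact Omega_two_three 4 3
  rw [this]

end wreath

theorem iterate (X : Type) [Group X] [Finite X] (d w : ℕ) (h : DerivedLengthEq X (d + 1))
    (hw : Omega (Nat.card X) = w) (r : ℕ) :
    ∃ (G : Type) (_ : Group G) (_ : Finite G), DerivedLengthEq G (5 * r + d + 1) ∧
      8 * Omega (Nat.card G) + 7 = (8 * w + 7) * 9 ^ r := by
  induction r with
  | zero => exact ⟨X, inferInstance, inferInstance, by simpa using h, by simp [hw]⟩
  | succ r ih =>
    obtain ⟨G, _, _, hG, hO⟩ := ih
    refine ⟨W G, inferInstance, W_finite, ?_, ?_⟩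
    · have := W_length hG
      rwa [show 5 * (r + 1) + d + 1 = 5 + (5 * r + d) + 1 by ring]
    · rw [W_Omega, pow_succ]
      linarith

theorem base (k : ℕ) (hk1 : 1 ≤ k) (hk4 : k ≤ 4) :
    ∃ (X : Type) (_ : Group X) (_ : Finite X), DerivedLengthEq X (k - 1 + 1) ∧
      8 * Omega (Nat.card X) + 7 =
        (if k = 1 then 15 else if k = 2 then 23 else if k = 3 then 39 else 47) := by
  interval_cases k
  · refine ⟨Multiplicative (ZMod 2), inferInstance, inferInstance, derivedLengthEq_of ?_ ?_, ?_⟩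
    · rw [derivedSeries_one]
      exact (commutator_eq_bot_iff_center_eq_top _).2 CommGroup.center_eq_top
    · exact ne_bot_of_mem (x := Multiplicative.ofAdd 1) trivial (by decide)
    · have : Nat.card (Multiplicative (ZMod 2)) = 2 := Nat.card_zmod 2
      rw [this]
      norm_num [Omega]
  · refine ⟨DihedralGroup 3, inferInstance, inferInstance, derivedLengthEq_of ?_ ?_, ?_⟩
    · have h1 : derivedSeries (DihedralGroup 3) 1 ≤ Subgroup.zpowers (DihedralGroup.r 1) := by
        rw [derivedSeries_succ]
        refine Subgroup.commutator_le.2 fun a _ b _ => ?_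
        have : ∀ a b : DihedralGroup 3, ⁅a, b⁆ = DihedralGroup.r 1 ^ 0 ∨
            ⁅a, b⁆ = DihedralGroup.r 1 ^ 1 ∨ ⁅a, b⁆ = DihedralGroup.r 1 ^ 2 := by
          decide +kernel
        rcases this a b with h | h | h <;> rw [h] <;> exact Subgroup.npow_mem_zpowers _ _
      rw [eq_bot_iff, derivedSeries_succ]
      refine Subgroup.commutator_le.2 fun a ha b hb => ?_
      obtain ⟨i, rfl⟩ := h1 ha
      obtain ⟨j, rfl⟩ := h1 hb
      rw [Subgroup.mem_bot, commutatorElement_eq_one_iff_mul_comm]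
      exact zpow_mul_comm _ _ _
    · exact ne_bot_of_mem
        (comm_mem (n := 0) (x := DihedralGroup.r 1) (y := DihedralGroup.sr 0) trivial trivial)
        (by decide +kernel)
    · rw [DihedralGroup.nat_card]
      have := Omega_two_three 1 1
      norm_num at this ⊢
      rw [this]
  · refine ⟨S, inferInstance, inferInstance, S_length, ?_⟩
    rw [card_S]
    have := Omega_two_three 3 1
    norm_num at this ⊢
    rw [this]
  · refine ⟨L, inferInstance, inferInstance, L_length, ?_⟩
    rw [card_L]
    have := Omega_two_three 4 1
    norm_num at this ⊢
    rw [this]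

end Wr

/-- For every `r ≥ 1` and every `k ∈ {1, 2, 3, 4}` there is a finite solvable group with
derived length exactly `5r + k` and composition length `(aₖ·9^r − 7)/8`, where
`a₁ = 15`, `a₂ = 23`, `a₃ = 39`, `a₄ = 47` (e.g. the wreath products `S₂ wr G_m`,
`S₃ wr G_m`, `S₄ wr G_m` and `GL(2,3) wr G_m`, where `G_m` is the `r`-fold iterated
wreath product of `G₉ = F₃² ⋊ GL(2, F₃)`). -/
theorem exists_solvable_derived_length_five_mul_add (r : ℕ) (hr : 1 ≤ r)
    (k : ℕ) (hk1 : 1 ≤ k) (hk4 : k ≤ 4) :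
    ∃ (G : Type) (_ : Group G) (_ : Finite G), IsSolvable G ∧
      DerivedLengthEq G (5 * r + k) ∧
      Omega (Nat.card G) =
        ((if k = 1 then 15 else if k = 2 then 23 else if k = 3 then 39 else 47)
          * 9 ^ r - 7) / 8 := by
  obtain ⟨X, _, _, hX, hw⟩ := Wr.base k hk1 hk4
  obtain ⟨G, _, _, hG, hO⟩ := Wr.iterate X (k - 1) _ hX rfl r
  rw [hw] at hO
  refine ⟨G, inferInstance, inferInstance, ⟨⟨_, hG.1⟩⟩, ?_, ?_⟩
  · rwa [show 5 * r + k = 5 * r + (k - 1) + 1 by omega]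
  · rw [← hO]
    omega
end
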